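/- arXiv:1907.01994 — 2 statements merged into one kernel-verified Lean document; each statement's English description precedes it below -/
import Mathlib

section
/- Under the stated assumptions on b and ρ, the relative entropy with respect to the standard Gaussian measure μ decays exponentially: for every t ≥ 0, ∫_{ℝ^d} ρ(t,·) log ρ(t,·) dμ ≤ e^{−2αt} ∫_{ℝ^d} ρ(0,·) log ρ(0,·) dμ + (1 − e^{−2αt}) m log m, where m = ∫_{ℝ^d} ρ(0,·) dμ. -/
open MeasureTheory Real RealInnerProductSpace

/-- The standard Gaussian measure on `ℝ^d`. -/
noncomputable def stdGauss (d : ℕ) : Measure (EuclideanSpace ℝ (Fin d)) :=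
  volume.withDensity fun ξ =>
    ENNReal.ofReal ((2 * π) ^ (-(d : ℝ) / 2) * Real.exp (-‖ξ‖ ^ 2 / 2))

/-- The Laplacian of a function on `ℝ^d`, as the divergence (trace of the derivative)
of its gradient. -/
noncomputable def lap (d : ℕ) (f : EuclideanSpace ℝ (Fin d) → ℝ)
    (ξ : EuclideanSpace ℝ (Fin d)) : ℝ :=
  LinearMap.trace ℝ (EuclideanSpace ℝ (Fin d))
    (fderiv ℝ (fun x => gradient f x) ξ :
      EuclideanSpace ℝ (Fin d) →ₗ[ℝ] EuclideanSpace ℝ (Fin d))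


section Aux

open ProbabilityTheory

noncomputable def gd (d : ℕ) (ξ : EuclideanSpace ℝ (Fin d)) : ℝ :=
  (2 * π) ^ (-(d : ℝ) / 2) * Real.exp (-‖ξ‖ ^ 2 / 2)

lemma gd_nonneg (d : ℕ) (ξ : EuclideanSpace ℝ (Fin d)) : 0 ≤ gd d ξ := by
  unfold gd; positivity

lemma gd_cont (d : ℕ) : Continuous (gd d) := by
  unfold gd; fun_prop

lemma gd_hasFDerivAt (d : ℕ) (ξ : EuclideanSpace ℝ (Fin d)) :
    HasFDerivAt (gd d) (-(gd d ξ) • innerSL ℝ ξ) ξ := by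
  have h1 : HasFDerivAt (fun x : EuclideanSpace ℝ (Fin d) => ‖x‖ ^ 2) (2 • innerSL ℝ ξ) ξ :=
    (hasStrictFDerivAt_norm_sq ξ).hasFDerivAt
  have h2 := ((h1.const_mul (-1/2 : ℝ)).exp).const_mul ((2 * π) ^ (-(d : ℝ) / 2))
  convert! h2 using 1
  · ext x; simp only [gd]; congr 2; ring
  · ext x; simp only [gd]
    simp
    rw [show -‖ξ‖ ^ 2 / 2 = -1/2 * ‖ξ‖ ^ 2 by ring]
    ring

lemma integral_stdGauss {d : ℕ} (f : EuclideanSpace ℝ (Fin d) → ℝ) :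
    ∫ x, f x ∂(stdGauss d) = ∫ x, gd d x * f x := by
  unfold stdGauss
  rw [integral_withDensity_eq_integral_toReal_smul₀]
  · refine integral_congr_ae (Filter.Eventually.of_forall fun x => ?_)
    simp only [smul_eq_mul]
    rw [ENNReal.toReal_ofReal (by positivity)]; rfl
  · exact ((gd_cont d).measurable.ennreal_ofReal).aemeasurable
  · simp

lemma integrable_stdGauss_iff {d : ℕ} (f : EuclideanSpace ℝ (Fin d) → ℝ) :
    Integrable f (stdGauss d) ↔ Integrable fun x => gd d x * f x := by
  unfold stdGauss
  rw [integrable_withDensity_iff_integrable_smul₀']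
  · refine integrable_congr (Filter.Eventually.of_forall fun x => ?_)
    simp only [smul_eq_mul]
    rw [ENNReal.toReal_ofReal (by positivity)]; rfl
  · exact ((gd_cont d).measurable.ennreal_ofReal).aemeasurable
  · simp

lemma stdGauss_eq (d : ℕ) : stdGauss d = stdGaussian (EuclideanSpace ℝ (Fin d)) := by
  have hint : Integrable (gd d) := by
    have h := (GaussianFourier.integrable_cexp_neg_mul_sq_norm_add
      (b := (1/2 : ℂ)) (by norm_num) 0 (0 : EuclideanSpace ℝ (Fin d))).norm
    refine (h.const_mul ((2 * π) ^ (-(d : ℝ) / 2))).congr (Filter.Eventually.of_forall fun x => ?_)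
    simp only [gd, Complex.norm_exp]
    congr 2
    simp
    norm_cast
    ring
  have : IsFiniteMeasure (stdGauss d) := by
    unfold stdGauss
    apply isFiniteMeasure_withDensity_ofReal
    exact hint.2
  apply Measure.ext_of_charFun
  ext t
  rw [charFun_stdGaussian, charFun_apply]
  unfold stdGauss
  rw [integral_withDensity_eq_integral_toReal_smul₀]
  · have key := GaussianFourier.integral_cexp_neg_mul_sq_norm_add
      (b := (1/2 : ℂ)) (by norm_num) Complex.I t
    have e : ∀ x : EuclideanSpace ℝ (Fin d), (ENNReal.ofReal ((2 * π) ^ (-(d : ℝ) / 2) * Real.exp (-‖x‖ ^ 2 / 2))).toReal • Complex.exp (inner ℝ x t * Complex.I) = (((2 * π) ^ (-(d : ℝ) / 2) : ℝ) : ℂ) * Complex.exp (-(1/2) * ‖x‖ ^ 2 + Complex.I * inner ℝ t x) := by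
      intro x
      rw [ENNReal.toReal_ofReal (by positivity), Complex.exp_add, real_inner_comm]
      simp
      rw [mul_assoc, mul_comm Complex.I]
      congr 3
      ring
    simp_rw [e]
    rw [integral_const_mul, key]
    rw [← mul_assoc]
    have : (((2 * π) ^ (-(d : ℝ) / 2) : ℝ) : ℂ) * (π / (1/2 : ℂ)) ^ ((Module.finrank ℝ (EuclideanSpace ℝ (Fin d)) : ℂ) / 2) = 1 := by
      have h3 : (π / (1/2 : ℂ)) ^ ((Module.finrank ℝ (EuclideanSpace ℝ (Fin d)) : ℂ) / 2) = (((2 * π) ^ ((d : ℝ) / 2) : ℝ) : ℂ) := by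
        rw [Complex.ofReal_cpow (by positivity)]
        simp
        congr 1
        ring
      rw [h3, ← Complex.ofReal_mul, ← Real.rpow_add (by positivity)]
      rw [show -(d:ℝ)/2 + d/2 = 0 by ring]
      simp
    rw [this]
    simp
    congr 1
    ring
  · exact ((gd_cont d).measurable.ennreal_ofReal).aemeasurable
  · simp

instance (d : ℕ) : IsGaussian (stdGauss d) := by
  rw [stdGauss_eq]; infer_instance

lemma stdGauss_rot (d : ℕ) (θ : ℝ) : 
    ((stdGauss d).prod (stdGauss d)).map (ContinuousLinearMap.rotation θ) = (stdGauss d).prod (stdGauss d) := by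
  apply IsGaussian.map_rotation_eq_self_of_forall_strongDual_eq_zero
  rw [stdGauss_eq]
  exact integral_strongDual_stdGaussian

lemma integrable_norm_stdGauss (d : ℕ) : Integrable (fun x => ‖x‖) (stdGauss d) :=
  (IsGaussian.integrable_id (μ := stdGauss d)).norm

lemma integrable_of_lin {d : ℕ} {f : EuclideanSpace ℝ (Fin d) → ℝ}
    (hf : AEStronglyMeasurable f (stdGauss d)) (C D : ℝ) (h : ∀ x, |f x| ≤ C + D * ‖x‖) :
    Integrable f (stdGauss d) :=
  Integrable.mono' ((integrable_const C).add ((integrable_norm_stdGauss d).const_mul D)) hf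
    (Filter.Eventually.of_forall h)

/-- scalar Gaussian integration by parts. -/
lemma gibp {d : ℕ} (u : EuclideanSpace ℝ (Fin d) → ℝ) (hu : Differentiable ℝ u) (C D : ℝ)
    (hC : ∀ x, |u x| ≤ C) (hD : ∀ x, ‖fderiv ℝ u x‖ ≤ D) (v : EuclideanSpace ℝ (Fin d)) :
    Integrable (fun x => fderiv ℝ u x v) (stdGauss d) ∧
    Integrable (fun x => ⟪x, v⟫ * u x) (stdGauss d) ∧
    ∫ x, fderiv ℝ u x v ∂(stdGauss d) = ∫ x, ⟪x, v⟫ * u x ∂(stdGauss d) := by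
  have i1 : Integrable (fun x => fderiv ℝ u x v) (stdGauss d) := by
    refine integrable_of_lin (measurable_fderiv_apply_const ℝ u v).aestronglyMeasurable (D * ‖v‖) 0 ?_
    intro x
    simp only [zero_mul, add_zero]
    exact ((fderiv ℝ u x).le_opNorm v).trans (by gcongr; exact hD x)
  have i2 : Integrable (fun x => ⟪x, v⟫ * u x) (stdGauss d) := by
    have := hu.continuous
    refine integrable_of_lin (Continuous.aestronglyMeasurable (by fun_prop)) 0 (‖v‖ * C) ?_
    intro x
    rw [abs_mul, zero_add]
    calc _ ≤ (‖x‖ * ‖v‖) * C := by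
          gcongr
          · exact abs_real_inner_le_norm x v
          · exact hC x
      _ = _ := by ring
  have i3 : Integrable u (stdGauss d) :=
    integrable_of_lin hu.continuous.aestronglyMeasurable C 0 (by simpa using hC)
  refine ⟨i1, i2, ?_⟩
  rw [integral_stdGauss, integral_stdGauss]
  rw [integrable_stdGauss_iff] at i1 i2 i3
  have hf : ∀ x, fderiv ℝ (gd d) x v = - (gd d x * ⟪x, v⟫) := by
    intro x; rw [(gd_hasFDerivAt d x).fderiv]; simp
  rw [integral_mul_fderiv_eq_neg_fderiv_mul_of_integrable _ i1 i3]
  · rw [← integral_neg]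
    congr 1; ext x; rw [hf]; ring
  · exact fun x _ => (gd_hasFDerivAt d x).differentiableAt
  · exact fun x _ => hu x
  · refine i2.neg.congr (Filter.Eventually.of_forall fun x => ?_)
    simp only [hf, Pi.neg_apply]; ring

/-- Gaussian divergence theorem. -/
lemma gdiv {d : ℕ} (V : EuclideanSpace ℝ (Fin d) → EuclideanSpace ℝ (Fin d))
    (hV : Differentiable ℝ V) (C D : ℝ)
    (hC : ∀ x, ‖V x‖ ≤ C) (hD : ∀ x, ‖fderiv ℝ V x‖ ≤ D) :
    Integrable (fun x => LinearMap.trace ℝ (EuclideanSpace ℝ (Fin d)) (fderiv ℝ V x :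
      EuclideanSpace ℝ (Fin d) →ₗ[ℝ] EuclideanSpace ℝ (Fin d)) - ⟪x, V x⟫) (stdGauss d) ∧
    ∫ x, (LinearMap.trace ℝ (EuclideanSpace ℝ (Fin d)) (fderiv ℝ V x :
      EuclideanSpace ℝ (Fin d) →ₗ[ℝ] EuclideanSpace ℝ (Fin d)) - ⟪x, V x⟫) ∂(stdGauss d) = 0 := by
  let e := EuclideanSpace.basisFun (Fin d) ℝ
  have hfd : ∀ i x, HasFDerivAt (fun x => ⟪e i, V x⟫) ((innerSL ℝ (e i)).comp (fderiv ℝ V x)) x := by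
    intro i x
    exact (innerSL ℝ (e i)).hasFDerivAt.comp x (hV x).hasFDerivAt
  have key : ∀ i, _ := fun i => gibp (fun x => ⟪e i, V x⟫) (fun x => (hfd i x).differentiableAt) C D
    (fun x => by
      refine (abs_real_inner_le_norm _ _).trans ?_
      simpa using hC x)
    (fun x => by
      rw [(hfd i x).fderiv]
      refine (ContinuousLinearMap.opNorm_comp_le _ _).trans ?_
      simpa using hD x) (e i)
  have eq : (fun x => LinearMap.trace ℝ (EuclideanSpace ℝ (Fin d)) (fderiv ℝ V x :
      EuclideanSpace ℝ (Fin d) →ₗ[ℝ] EuclideanSpace ℝ (Fin d)) - ⟪x, V x⟫) = 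
      fun x => ∑ i, (fderiv ℝ (fun x => ⟪e i, V x⟫) x (e i) - ⟪x, e i⟫ * ⟪e i, V x⟫) := by
    ext x
    rw [LinearMap.trace_eq_sum_inner _ e, Finset.sum_sub_distrib, e.sum_inner_mul_inner]
    congr 1
    refine Finset.sum_congr rfl fun i _ => ?_
    rw [(hfd i x).fderiv]; simp
  rw [eq]
  constructor
  · exact integrable_finsetSum _ fun i _ => (key i).1.sub (key i).2.1
  · rw [integral_finsetSum _ fun i _ => by exact (key i).1.sub (key i).2.1]
    refine Finset.sum_eq_zero fun i _ => ?_
    rw [integral_sub (key i).1 (key i).2.1, (key i).2.2, sub_self]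

structure NiceFn (d : ℕ) (f : EuclideanSpace ℝ (Fin d) → ℝ)
    (g : EuclideanSpace ℝ (Fin d) → EuclideanSpace ℝ (Fin d)) (ε C D : ℝ) : Prop where
  hε : 0 < ε
  lo : ∀ x, ε ≤ f x
  hi : ∀ x, f x ≤ C
  hf : ∀ x, HasFDerivAt f (innerSL ℝ (g x)) x
  hg : Continuous g
  hD : ∀ x, ‖g x‖ ≤ D

lemma rot_int {d : ℕ} (θ : ℝ) (G : EuclideanSpace ℝ (Fin d) × EuclideanSpace ℝ (Fin d) → ℝ)
    (hG : Continuous G) :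
    ∫ p, G (Real.cos θ • p.1 + Real.sin θ • p.2, -Real.sin θ • p.1 + Real.cos θ • p.2)
      ∂((stdGauss d).prod (stdGauss d)) = ∫ p, G p ∂((stdGauss d).prod (stdGauss d)) := by
  conv_rhs => rw [← stdGauss_rot d θ]
  rw [integral_map (by fun_prop) hG.aestronglyMeasurable]
  rfl

lemma integrable_of_lin2 {d : ℕ} {G : EuclideanSpace ℝ (Fin d) × EuclideanSpace ℝ (Fin d) → ℝ}
    (hG : Continuous G) (A B B' : ℝ) (h : ∀ p, |G p| ≤ A + B * ‖p.1‖ + B' * ‖p.2‖) :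
    Integrable G ((stdGauss d).prod (stdGauss d)) := by
  refine Integrable.mono' (((integrable_const A).add
    (((integrable_norm_stdGauss d).comp_fst (stdGauss d)).const_mul B)).add
    (((integrable_norm_stdGauss d).comp_snd (stdGauss d)).const_mul B')) hG.aestronglyMeasurable
    (Filter.Eventually.of_forall h)

lemma integrable_of_bdd {d : ℕ} {F : Type*} [NormedAddCommGroup F]
    {f : EuclideanSpace ℝ (Fin d) → F} (hf : AEStronglyMeasurable f (stdGauss d)) (C : ℝ)
    (h : ∀ x, ‖f x‖ ≤ C) : Integrable f (stdGauss d) :=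
  Integrable.mono' (integrable_const C) hf (Filter.Eventually.of_forall h)

noncomputable def PP {d : ℕ} {F : Type*} [NormedAddCommGroup F] [NormedSpace ℝ F]
    (f : EuclideanSpace ℝ (Fin d) → F) (θ : ℝ) (x : EuclideanSpace ℝ (Fin d)) : F :=
  ∫ y, f (Real.cos θ • x + Real.sin θ • y) ∂(stdGauss d)

noncomputable def RR {d : ℕ} (g : EuclideanSpace ℝ (Fin d) → EuclideanSpace ℝ (Fin d))
    (θ : ℝ) (x : EuclideanSpace ℝ (Fin d)) : ℝ :=
  ∫ y, ⟪g (Real.cos θ • x + Real.sin θ • y), -Real.sin θ • x + Real.cos θ • y⟫ ∂(stdGauss d)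

namespace NiceFn

variable {d : ℕ} {f : EuclideanSpace ℝ (Fin d) → ℝ}
    {g : EuclideanSpace ℝ (Fin d) → EuclideanSpace ℝ (Fin d)} {ε C D : ℝ}

lemma cont (h : NiceFn d f g ε C D) : Continuous f :=
  continuous_iff_continuousAt.2 fun x => (h.hf x).continuousAt

lemma pos (h : NiceFn d f g ε C D) (x) : 0 < f x := h.hε.trans_le (h.lo x)

lemma norm_le (h : NiceFn d f g ε C D) (x) : ‖f x‖ ≤ C := by
  rw [Real.norm_eq_abs, abs_of_pos (h.pos x)]; exact h.hi x

lemma D_nonneg (h : NiceFn d f g ε C D) : 0 ≤ D := (norm_nonneg _).trans (h.hD 0)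

lemma int_slice (h : NiceFn d f g ε C D) (θ : ℝ) (x) :
    Integrable (fun y => f (Real.cos θ • x + Real.sin θ • y)) (stdGauss d) := by
  have := h.cont
  exact integrable_of_bdd (Continuous.aestronglyMeasurable (by fun_prop)) C fun y => h.norm_le _

lemma int_slice_g (h : NiceFn d f g ε C D) (θ : ℝ) (x) :
    Integrable (fun y => g (Real.cos θ • x + Real.sin θ • y)) (stdGauss d) := by
  have := h.hg
  exact integrable_of_bdd (Continuous.aestronglyMeasurable (by fun_prop)) D fun y => h.hD _

lemma P_lo (h : NiceFn d f g ε C D) (θ : ℝ) (x) : ε ≤ PP f θ x := by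
  have := integral_mono (integrable_const ε) (h.int_slice θ x) (fun y => h.lo _)
  simpa [PP] using this

lemma P_hi (h : NiceFn d f g ε C D) (θ : ℝ) (x) : PP f θ x ≤ C := by
  have := integral_mono (h.int_slice θ x) (integrable_const C) (fun y => h.hi _)
  simpa [PP] using this

lemma P_pos (h : NiceFn d f g ε C D) (θ : ℝ) (x) : 0 < PP f θ x := h.hε.trans_le (h.P_lo θ x)

lemma q_bd (h : NiceFn d f g ε C D) (θ : ℝ) (x) : ‖PP g θ x‖ ≤ D := by
  have := norm_integral_le_of_norm_le_const (μ := stdGauss d)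
    (f := fun y => g (Real.cos θ • x + Real.sin θ • y)) (C := D)
    (Filter.Eventually.of_forall fun y => h.hD _)
  simpa [PP] using this

lemma q_cont (h : NiceFn d f g ε C D) (θ : ℝ) : Continuous (PP g θ) := by
  have := h.hg
  refine continuous_of_dominated (bound := fun _ => D) ?_ ?_ (integrable_const D) ?_
  · intro x; exact Continuous.aestronglyMeasurable (by fun_prop)
  · intro x; exact Filter.Eventually.of_forall fun y => h.hD _
  · exact Filter.Eventually.of_forall fun y => by fun_prop

lemma P_fderiv (h : NiceFn d f g ε C D) (θ : ℝ) (x) :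
    HasFDerivAt (PP f θ) (Real.cos θ • innerSL ℝ (PP g θ x)) x := by
  have hc := h.cont
  have hgc := h.hg
  have key := hasFDerivAt_integral_of_dominated_of_fderiv_le (μ := stdGauss d) (𝕜 := ℝ)
    (F := fun x y => f (Real.cos θ • x + Real.sin θ • y))
    (F' := fun x y => Real.cos θ • innerSL ℝ (g (Real.cos θ • x + Real.sin θ • y)))
    (bound := fun _ => D) (x₀ := x) (s := Set.univ) Filter.univ_mem
    (Filter.Eventually.of_forall fun x => (h.int_slice θ x).1) (h.int_slice θ x)
    (Continuous.aestronglyMeasurable (by fun_prop))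
    (Filter.Eventually.of_forall fun y x _ => by
      rw [norm_smul, innerSL_apply_norm]
      calc _ ≤ 1 * D := by
            gcongr
            · exact Real.abs_cos_le_one θ
            · exact h.hD _
        _ = D := one_mul D)
    (integrable_const D)
    (Filter.Eventually.of_forall fun y x _ => by
      have h1 : HasFDerivAt (fun x : EuclideanSpace ℝ (Fin d) => Real.cos θ • x + Real.sin θ • y)
        (Real.cos θ • ContinuousLinearMap.id ℝ _) x := 
          (Real.cos θ • ContinuousLinearMap.id ℝ (EuclideanSpace ℝ (Fin d))).hasFDerivAt.add_const (Real.sin θ • y)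
      convert! (h.hf _).comp x h1 using 1
      ext v; simp)
  convert! key using 1
  rw [integral_smul, ContinuousLinearMap.integral_comp_comm _ (h.int_slice_g θ x)]
  rfl

lemma P_cont (h : NiceFn d f g ε C D) (θ : ℝ) : Continuous (PP f θ) :=
  continuous_iff_continuousAt.2 fun x => (h.P_fderiv θ x).continuousAt

lemma R_bd (h : NiceFn d f g ε C D) (θ : ℝ) (x y : EuclideanSpace ℝ (Fin d)) :
    |⟪g (Real.cos θ • x + Real.sin θ • y), -Real.sin θ • x + Real.cos θ • y⟫| ≤
      D * ‖x‖ + D * ‖y‖ := by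
  refine (abs_real_inner_le_norm _ _).trans ?_
  have h0 := h.D_nonneg
  rw [← mul_add]
  gcongr
  · exact h.hD _
  · refine (norm_add_le _ _).trans ?_
    rw [norm_smul, norm_smul, norm_neg]
    have := Real.abs_cos_le_one θ
    have := Real.abs_sin_le_one θ
    simp only [Real.norm_eq_abs]
    nlinarith [norm_nonneg x, norm_nonneg y]

lemma R_int (h : NiceFn d f g ε C D) (θ : ℝ) (x : EuclideanSpace ℝ (Fin d)) :
    Integrable (fun y => ⟪g (Real.cos θ • x + Real.sin θ • y), -Real.sin θ • x + Real.cos θ • y⟫)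
      (stdGauss d) := by
  have hgc := h.hg
  exact integrable_of_lin (Continuous.aestronglyMeasurable (by fun_prop)) (D * ‖x‖) D (h.R_bd θ x)

lemma R_le (h : NiceFn d f g ε C D) (θ : ℝ) (x : EuclideanSpace ℝ (Fin d)) :
    |RR g θ x| ≤ D * (∫ y, ‖y‖ ∂(stdGauss d)) + D * ‖x‖ := by
  have hi : Integrable (fun y => D * ‖x‖ + D * ‖y‖) (stdGauss d) :=
    (integrable_const (D * ‖x‖)).add ((integrable_norm_stdGauss d).const_mul D)
  unfold RR
  refine (norm_integral_le_of_norm_le (f := fun y => ⟪g (Real.cos θ • x + Real.sin θ • y),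
    -Real.sin θ • x + Real.cos θ • y⟫) hi
    (Filter.Eventually.of_forall fun y => h.R_bd θ x y)).trans (le_of_eq ?_)
  rw [integral_add (integrable_const _) ((integrable_norm_stdGauss d).const_mul D),
    integral_const_mul D (fun y : EuclideanSpace ℝ (Fin d) => ‖y‖)]
  simp
  ring

lemma P_deriv (h : NiceFn d f g ε C D) (θ : ℝ) (x) :
    HasDerivAt (fun θ => PP f θ x) (RR g θ x) θ := by
  have hc := h.cont
  have hgc := h.hg
  refine (hasDerivAt_integral_of_dominated_loc_of_deriv_le (μ := stdGauss d) (𝕜 := ℝ)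
    (F := fun θ y => f (Real.cos θ • x + Real.sin θ • y))
    (F' := fun θ y => ⟪g (Real.cos θ • x + Real.sin θ • y), -Real.sin θ • x + Real.cos θ • y⟫)
    (bound := fun y => D * ‖x‖ + D * ‖y‖) (x₀ := θ) (s := Set.univ) Filter.univ_mem
    (Filter.Eventually.of_forall fun θ => (h.int_slice θ x).1) (h.int_slice θ x)
    (h.R_int θ x).1
    (Filter.Eventually.of_forall fun y θ _ => h.R_bd θ x y)
    ((integrable_const _).add ((integrable_norm_stdGauss d).const_mul D))
    (Filter.Eventually.of_forall fun y θ _ => ?_)).2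
  have h1 : HasDerivAt (fun θ => Real.cos θ • x + Real.sin θ • y)
    (-Real.sin θ • x + Real.cos θ • y) θ :=
    ((Real.hasDerivAt_cos θ).smul_const x).add ((Real.hasDerivAt_sin θ).smul_const y)
  exact (h.hf _).comp_hasDerivAt θ h1

lemma R_meas (h : NiceFn d f g ε C D) (θ : ℝ) : AEStronglyMeasurable (RR g θ) (stdGauss d) := by
  have hgc := h.hg
  refine AEStronglyMeasurable.integral_prod_right' (μ := stdGauss d) (ν := stdGauss d)
    (f := fun p : EuclideanSpace ℝ (Fin d) × EuclideanSpace ℝ (Fin d) =>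
      ⟪g (Real.cos θ • p.1 + Real.sin θ • p.2), -Real.sin θ • p.1 + Real.cos θ • p.2⟫) ?_
  exact Continuous.aestronglyMeasurable (by fun_prop)

lemma log_bd {ε C r : ℝ} (hε : 0 < ε) (h1 : ε ≤ r) (h2 : r ≤ C) :
    |Real.log r + 1| ≤ |Real.log ε| + |Real.log C| + 1 := by
  have a := Real.log_le_log hε h1
  have b := Real.log_le_log (hε.trans_le h1) h2
  rw [abs_le]
  constructor
  · linarith [neg_abs_le (Real.log ε), abs_nonneg (Real.log C)]
  · linarith [le_abs_self (Real.log C), abs_nonneg (Real.log ε)]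

lemma logP_cont (h : NiceFn d f g ε C D) (θ : ℝ) :
    Continuous fun x => Real.log (PP f θ x) + 1 :=
  ((h.P_cont θ).log fun x => (h.P_pos θ x).ne').add continuous_const

lemma H_deriv (h : NiceFn d f g ε C D) (θ : ℝ) :
    HasDerivAt (fun θ => ∫ x, PP f θ x * Real.log (PP f θ x) ∂(stdGauss d))
      (∫ x, (Real.log (PP f θ x) + 1) * RR g θ x ∂(stdGauss d)) θ := by
  set K := |Real.log ε| + |Real.log C| + 1 with hK
  have hmc : ∀ θ, Continuous fun x => PP f θ x * Real.log (PP f θ x) := fun θ =>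
    (h.P_cont θ).mul ((h.P_cont θ).log fun x => (h.P_pos θ x).ne')
  refine (hasDerivAt_integral_of_dominated_loc_of_deriv_le (μ := stdGauss d) (𝕜 := ℝ)
    (F := fun θ x => PP f θ x * Real.log (PP f θ x))
    (F' := fun θ x => (Real.log (PP f θ x) + 1) * RR g θ x)
    (bound := fun x => K * (D * (∫ y, ‖y‖ ∂(stdGauss d)) + D * ‖x‖))
    (x₀ := θ) (s := Set.univ) Filter.univ_mem
    (Filter.Eventually.of_forall fun θ => (hmc θ).aestronglyMeasurable)
    (integrable_of_bdd (hmc θ).aestronglyMeasurable (C * (K + 1)) fun x => ?_)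
    ((h.logP_cont θ).aestronglyMeasurable.mul (h.R_meas θ))
    (Filter.Eventually.of_forall fun x θ _ => ?_)
    (((integrable_const _).add ((integrable_norm_stdGauss d).const_mul D)).const_mul K)
    (Filter.Eventually.of_forall fun x θ _ => ?_)).2
  · rw [norm_mul]
    have h1 := log_bd h.hε (h.P_lo θ x) (h.P_hi θ x)
    have h2 := h.P_pos θ x
    have h3 := h.P_hi θ x
    rw [Real.norm_eq_abs, Real.norm_eq_abs, abs_of_pos h2]
    gcongr
    · linarith
    · have := abs_sub (Real.log (PP f θ x) + 1) 1
      simp at this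
      linarith
  · rw [norm_mul]
    gcongr
    · exact log_bd h.hε (h.P_lo θ x) (h.P_hi θ x)
    · exact h.R_le θ x
  · have h2 := h.P_pos θ x
    exact (Real.hasDerivAt_mul_log h2.ne').comp θ (h.P_deriv θ x)

end NiceFn

namespace NiceFn

variable {d : ℕ} {f : EuclideanSpace ℝ (Fin d) → ℝ}
    {g : EuclideanSpace ℝ (Fin d) → EuclideanSpace ℝ (Fin d)} {ε C D : ℝ}

lemma int_k (h : NiceFn d f g ε C D) :
    Continuous (fun z => ‖g z‖ ^ 2 / f z) ∧ ∀ z, |‖g z‖ ^ 2 / f z| ≤ D ^ 2 / ε := by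
  have hgc := h.hg
  refine ⟨Continuous.div (by fun_prop) h.cont fun x => (h.pos x).ne', fun z => ?_⟩
  have := h.pos z
  have h0 := h.hε
  rw [abs_of_nonneg (by positivity)]
  gcongr
  · exact h.hD z
  · exact h.lo z

/-- the derivative of the entropy along the interpolation. -/
lemma H_deriv_eq (h : NiceFn d f g ε C D) (θ : ℝ) :
    ∫ x, (Real.log (PP f θ x) + 1) * RR g θ x ∂(stdGauss d) =
      -(Real.sin θ * Real.cos θ) * ∫ x, ‖PP g θ x‖ ^ 2 / PP f θ x ∂(stdGauss d) := by
  set μ := stdGauss d with hμ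
  set K := |Real.log ε| + |Real.log C| + 1 with hK
  have hK0 : 0 ≤ K := by positivity
  have hgc := h.hg
  have hLc := h.logP_cont θ
  have hqc := h.q_cont θ
  have hPc := h.P_cont θ
  have hD0 := h.D_nonneg
  -- x as a function of (z, w)
  let G : EuclideanSpace ℝ (Fin d) × EuclideanSpace ℝ (Fin d) → ℝ := fun p =>
    (Real.log (PP f θ (Real.cos θ • p.1 - Real.sin θ • p.2)) + 1) * ⟪p.2, g p.1⟫
  let G2 : EuclideanSpace ℝ (Fin d) × EuclideanSpace ℝ (Fin d) → ℝ := fun p =>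
    ⟪PP g θ (Real.cos θ • p.1 - Real.sin θ • p.2), g p.1⟫ /
      PP f θ (Real.cos θ • p.1 - Real.sin θ • p.2)
  have hGc : Continuous G := by
    refine Continuous.mul ?_ (by fun_prop)
    exact hLc.comp (f := fun p : EuclideanSpace ℝ (Fin d) × EuclideanSpace ℝ (Fin d) =>
      Real.cos θ • p.1 - Real.sin θ • p.2) (by fun_prop)
  have hG2c : Continuous G2 := by
    refine Continuous.div ?_ ?_ fun p => (h.P_pos θ _).ne'
    · fun_prop
    · fun_prop
  have rotx : ∀ p : EuclideanSpace ℝ (Fin d) × EuclideanSpace ℝ (Fin d),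
      Real.cos θ • (Real.cos θ • p.1 + Real.sin θ • p.2) -
        Real.sin θ • (-Real.sin θ • p.1 + Real.cos θ • p.2) = p.1 := by
    intro p
    have e : Real.cos θ • (Real.cos θ • p.1 + Real.sin θ • p.2) -
        Real.sin θ • (-Real.sin θ • p.1 + Real.cos θ • p.2) =
        (Real.sin θ ^ 2 + Real.cos θ ^ 2) • p.1 := by module
    rw [e, Real.sin_sq_add_cos_sq, one_smul]
  have hGb : ∀ p, |G p| ≤ 0 + 0 * ‖p.1‖ + (K * D) * ‖p.2‖ := by
    intro p
    simp only [G, abs_mul]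
    calc _ ≤ K * (‖p.2‖ * D) := by
          gcongr
          · exact log_bd h.hε (h.P_lo θ _) (h.P_hi θ _)
          · refine (abs_real_inner_le_norm _ _).trans ?_
            gcongr
            exact h.hD _
      _ = _ := by ring
  have hG2b : ∀ p, |G2 p| ≤ D * D / ε := by
    intro p
    simp only [G2, abs_div]
    have := h.hε
    rw [abs_of_pos (h.P_pos θ _)]
    gcongr
    · refine (abs_real_inner_le_norm _ _).trans ?_
      gcongr
      · exact h.q_bd _ _
      · exact h.hD _
    · exact h.P_lo _ _
  have hGi : Integrable G (μ.prod μ) := integrable_of_lin2 hGc _ _ _ hGb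
  have hG2i : Integrable G2 (μ.prod μ) := integrable_of_lin2 hG2c (D * D / ε) 0 0
    (by simpa using hG2b)
  have s1 : ∫ x, (Real.log (PP f θ x) + 1) * RR g θ x ∂μ = ∫ p, G p ∂(μ.prod μ) := by
    rw [← rot_int θ G hGc, ← hμ, integral_prod]
    · congr 1; ext x
      simp only [RR]
      rw [← integral_const_mul]
      congr 1; ext y
      simp only [G]
      rw [rotx (x, y), real_inner_comm]
    · refine integrable_of_lin2 (hGc.comp (by fun_prop)) 0 (K * D) (K * D) ?_
      intro p
      simp only [G]
      rw [rotx p, real_inner_comm, abs_mul]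
      calc _ ≤ K * (D * ‖p.1‖ + D * ‖p.2‖) := by
            gcongr
            · exact log_bd h.hε (h.P_lo θ _) (h.P_hi θ _)
            · exact h.R_bd θ p.1 p.2
        _ = _ := by ring
  have s2 : ∫ p, G p ∂(μ.prod μ) = -(Real.sin θ * Real.cos θ) * ∫ p, G2 p ∂(μ.prod μ) := by
    rw [integral_prod _ hGi, integral_prod _ hG2i, ← integral_const_mul]
    congr 1; ext z
    rw [← integral_const_mul]
    have hu : ∀ w, HasFDerivAt (fun w => Real.log (PP f θ (Real.cos θ • z - Real.sin θ • w)) + 1)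
        ((-(Real.sin θ * Real.cos θ) / PP f θ (Real.cos θ • z - Real.sin θ • w)) •
          innerSL ℝ (PP g θ (Real.cos θ • z - Real.sin θ • w))) w := by
      intro w
      have h1 : HasFDerivAt (fun w => Real.cos θ • z - Real.sin θ • w)
          (-(Real.sin θ • ContinuousLinearMap.id ℝ (EuclideanSpace ℝ (Fin d)))) w :=
        (Real.sin θ • ContinuousLinearMap.id ℝ (EuclideanSpace ℝ (Fin d))).hasFDerivAt.const_sub
          (Real.cos θ • z)
      have h2 := ((h.P_fderiv θ (Real.cos θ • z - Real.sin θ • w)).comp w h1)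
      have h3 := (h2.log (h.P_pos θ _).ne').add_const (1 : ℝ)
      convert! h3 using 1
      ext v
      simp
      ring
    have key := gibp _ (fun w => (hu w).differentiableAt) K (D / ε)
      (fun w => log_bd h.hε (h.P_lo θ _) (h.P_hi θ _))
      (fun w => by
        have := h.hε
        rw [(hu w).fderiv, norm_smul, innerSL_apply_norm, norm_div, Real.norm_eq_abs,
          Real.norm_eq_abs, abs_neg, abs_mul, abs_of_pos (h.P_pos θ _), div_mul_eq_mul_div]
        gcongr
        · calc _ ≤ (1 * 1) * D := by
                gcongr
                · exact Real.abs_sin_le_one θ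
                · exact Real.abs_cos_le_one θ
                · exact h.q_bd _ _
            _ = D := by ring
        · exact h.P_lo _ _) (g z)
    have key := key.2.2
    calc _ = _ := by congr 1; ext w; simp only [G]; rw [mul_comm]
      _ = _ := key.symm
      _ = _ := by
        congr 1; ext w
        rw [(hu w).fderiv]
        simp [G2]
        ring
  have s3 : ∫ p, G2 p ∂(μ.prod μ) = ∫ x, ‖PP g θ x‖ ^ 2 / PP f θ x ∂μ := by
    rw [← rot_int θ G2 hG2c, ← hμ, integral_prod]
    · congr 1; ext x
      simp only [G2]
      simp_rw [rotx (x, _)]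
      rw [integral_div]
      congr 1
      rw [integral_inner (h.int_slice_g θ x)]
      exact real_inner_self_eq_norm_sq _
    · exact integrable_of_lin2 (hG2c.comp (by fun_prop)) (D * D / ε) 0 0
        (fun p => by simpa using hG2b _)
  rw [s1, s2, s3]

lemma S_le (h : NiceFn d f g ε C D) (θ : ℝ) :
    ∫ x, ‖PP g θ x‖ ^ 2 / PP f θ x ∂(stdGauss d) ≤ ∫ x, ‖g x‖ ^ 2 / f x ∂(stdGauss d) := by
  set μ := stdGauss d with hμ
  obtain ⟨kc, kb⟩ := h.int_k
  have hqc := h.q_cont θ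
  have hPc := h.P_cont θ
  have e0 := h.hε
  have ipr : Integrable (fun p : EuclideanSpace ℝ (Fin d) × EuclideanSpace ℝ (Fin d) =>
      ‖g (Real.cos θ • p.1 + Real.sin θ • p.2)‖ ^ 2 / f (Real.cos θ • p.1 + Real.sin θ • p.2))
      (μ.prod μ) :=
    integrable_of_lin2 (kc.comp (f := fun p : EuclideanSpace ℝ (Fin d) × EuclideanSpace ℝ (Fin d) =>
      Real.cos θ • p.1 + Real.sin θ • p.2) (by fun_prop)) (D ^ 2 / ε) 0 0
      (fun p => by simpa using kb _)
  have e1 : ∫ x, ‖g x‖ ^ 2 / f x ∂μ = ∫ x, ∫ y, ‖g (Real.cos θ • x + Real.sin θ • y)‖ ^ 2 /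
      f (Real.cos θ • x + Real.sin θ • y) ∂μ ∂μ := by
    have := rot_int (d := d) θ (fun p => ‖g p.1‖ ^ 2 / f p.1) (kc.comp continuous_fst)
    rw [← hμ] at this
    simp only at this
    rw [integral_prod _ ipr] at this
    rw [this, integral_fun_fst (μ := μ) (ν := μ) (fun x => ‖g x‖ ^ 2 / f x)]
    simp
  rw [e1]
  refine integral_mono ?_ ipr.integral_prod_left ?_
  · refine integrable_of_bdd (Continuous.aestronglyMeasurable
      (Continuous.div (by fun_prop) hPc fun x => (h.P_pos θ x).ne')) (D ^ 2 / ε) fun x => ?_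
    have := h.P_pos θ x
    rw [Real.norm_eq_abs, abs_of_nonneg (by positivity)]
    gcongr
    · exact h.q_bd θ x
    · exact h.P_lo θ x
  · intro x
    have hP := h.P_pos θ x
    set q := PP g θ x with hq
    set P := PP f θ x with hPd
    have iy : Integrable (fun y => ‖g (Real.cos θ • x + Real.sin θ • y)‖ ^ 2 /
      f (Real.cos θ • x + Real.sin θ • y)) μ :=
      integrable_of_bdd (Continuous.aestronglyMeasurable (kc.comp (f := fun y =>
        Real.cos θ • x + Real.sin θ • y) (by fun_prop))) (D ^ 2 / ε) (fun y => kb _)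
    have i1 : Integrable (fun y => 2 / P * ⟪q, g (Real.cos θ • x + Real.sin θ • y)⟫) μ :=
      ((h.int_slice_g θ x).const_inner q).const_mul _
    have i2 : Integrable (fun y => ‖q‖ ^ 2 / P ^ 2 * f (Real.cos θ • x + Real.sin θ • y)) μ :=
      (h.int_slice θ x).const_mul _
    have m := integral_mono (i1.sub i2) iy (fun y => by
      have hp := h.pos (Real.cos θ • x + Real.sin θ • y)
      set v := g (Real.cos θ • x + Real.sin θ • y)
      set r := f (Real.cos θ • x + Real.sin θ • y)
      simp only [Pi.sub_apply]
      rw [le_div_iff₀ hp]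
      have hs := norm_sub_sq_real ((r / P) • q) v
      have hn := sq_nonneg ‖(r / P) • q - v‖
      rw [hs, norm_smul, inner_smul_left, mul_pow, Real.norm_eq_abs, sq_abs] at hn
      simp only [conj_trivial] at hn
      have : (2 / P * ⟪q, v⟫ - ‖q‖ ^ 2 / P ^ 2 * r) * r =
        2 * (r / P * ⟪q, v⟫) - (r / P) ^ 2 * ‖q‖ ^ 2 := by field_simp
      rw [this]; linarith)
    simp only [Pi.sub_apply] at m
    rw [integral_sub i1 i2, integral_const_mul, integral_const_mul,
      integral_inner (h.int_slice_g θ x)] at m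
    refine le_trans (le_of_eq ?_) m
    change ‖q‖ ^ 2 / P = 2 / P * ⟪q, q⟫ - ‖q‖ ^ 2 / P ^ 2 * P
    rw [real_inner_self_eq_norm_sq]
    field_simp
    ring

/-- Gaussian logarithmic Sobolev inequality. -/
lemma lsi (h : NiceFn d f g ε C D) :
    ∫ x, f x * Real.log (f x) ∂(stdGauss d) ≤
      (∫ x, f x ∂(stdGauss d)) * Real.log (∫ x, f x ∂(stdGauss d)) +
      (1 / 2) * ∫ x, ‖g x‖ ^ 2 / f x ∂(stdGauss d) := by
  set I := ∫ x, ‖g x‖ ^ 2 / f x ∂(stdGauss d) with hI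
  have hd : ∀ θ, HasDerivAt (fun θ => ∫ x, PP f θ x * Real.log (PP f θ x) ∂(stdGauss d) +
      1 / 2 * I * Real.sin θ ^ 2)
      (-(Real.sin θ * Real.cos θ) * ∫ x, ‖PP g θ x‖ ^ 2 / PP f θ x ∂(stdGauss d) +
        1 / 2 * I * (2 * Real.sin θ * Real.cos θ)) θ := by
    intro θ
    have h1 := h.H_deriv θ
    rw [h.H_deriv_eq] at h1
    have h2 := (((Real.hasDerivAt_sin θ).pow 2).const_mul (1 / 2 * I))
    refine h1.add ?_
    convert! h2 using 1
    simp
  have mono := monotoneOn_of_deriv_nonneg (convex_Icc (0 : ℝ) (π / 2))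
    (f := fun θ => ∫ x, PP f θ x * Real.log (PP f θ x) ∂(stdGauss d) +
      1 / 2 * I * Real.sin θ ^ 2)
    (fun θ _ => (hd θ).continuousAt.continuousWithinAt)
    (fun θ _ => (hd θ).differentiableAt.differentiableWithinAt)
    (fun θ hθ => by
      rw [(hd θ).deriv]
      rw [interior_Icc] at hθ
      have hs : 0 ≤ Real.sin θ := Real.sin_nonneg_of_nonneg_of_le_pi hθ.1.le
        (by linarith [hθ.2, Real.pi_pos])
      have hc : 0 ≤ Real.cos θ := Real.cos_nonneg_of_neg_pi_div_two_le_of_le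
        (by linarith [hθ.1, Real.pi_pos]) hθ.2.le
      have := mul_le_mul_of_nonneg_left (h.S_le θ) (mul_nonneg hs hc)
      rw [← hI] at this
      linarith)
  have := mono (a := 0) (b := π / 2) ⟨le_rfl, by positivity⟩ ⟨by positivity, le_rfl⟩ (by positivity)
  simpa [PP] using this

end NiceFn

lemma trace_le {d : ℕ} (A : EuclideanSpace ℝ (Fin d) →L[ℝ] EuclideanSpace ℝ (Fin d)) :
    |LinearMap.trace ℝ (EuclideanSpace ℝ (Fin d)) (A :
      EuclideanSpace ℝ (Fin d) →ₗ[ℝ] EuclideanSpace ℝ (Fin d))| ≤ d * ‖A‖ := by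
  rw [LinearMap.trace_eq_sum_inner _ (EuclideanSpace.basisFun (Fin d) ℝ)]
  refine (Finset.abs_sum_le_sum_abs _ _).trans ?_
  refine (Finset.sum_le_card_nsmul _ _ ‖A‖ fun i _ => ?_).trans (by simp)
  refine (abs_real_inner_le_norm _ _).trans ?_
  have := A.le_opNorm (EuclideanSpace.basisFun (Fin d) ℝ i)
  simpa using this

lemma trace_rank_one {d : ℕ} (a w : EuclideanSpace ℝ (Fin d)) :
    LinearMap.trace ℝ (EuclideanSpace ℝ (Fin d)) (((innerSL ℝ a).smulRight w :
      EuclideanSpace ℝ (Fin d) →L[ℝ] EuclideanSpace ℝ (Fin d)) :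
      EuclideanSpace ℝ (Fin d) →ₗ[ℝ] EuclideanSpace ℝ (Fin d)) = ⟪a, w⟫ := by
  rw [LinearMap.trace_eq_sum_inner _ (EuclideanSpace.basisFun (Fin d) ℝ),
    ← (EuclideanSpace.basisFun (Fin d) ℝ).sum_inner_mul_inner a w]
  refine Finset.sum_congr rfl fun i _ => ?_
  rw [ContinuousLinearMap.coe_coe, ContinuousLinearMap.smulRight_apply, inner_smul_right]
  rfl

lemma gdiv_smul {d : ℕ} (u : EuclideanSpace ℝ (Fin d) → ℝ)
    (gu W : EuclideanSpace ℝ (Fin d) → EuclideanSpace ℝ (Fin d))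
    (hu : ∀ x, HasFDerivAt u (innerSL ℝ (gu x)) x) (hW : Differentiable ℝ W) (A A' B B' : ℝ)
    (hA : ∀ x, |u x| ≤ A) (hA' : ∀ x, ‖gu x‖ ≤ A') (hB : ∀ x, ‖W x‖ ≤ B)
    (hB' : ∀ x, ‖fderiv ℝ W x‖ ≤ B') :
    Integrable (fun x => u x * LinearMap.trace ℝ (EuclideanSpace ℝ (Fin d)) (fderiv ℝ W x :
      EuclideanSpace ℝ (Fin d) →ₗ[ℝ] EuclideanSpace ℝ (Fin d)) + ⟪gu x, W x⟫ - u x * ⟪x, W x⟫)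
      (stdGauss d) ∧
    ∫ x, (u x * LinearMap.trace ℝ (EuclideanSpace ℝ (Fin d)) (fderiv ℝ W x :
      EuclideanSpace ℝ (Fin d) →ₗ[ℝ] EuclideanSpace ℝ (Fin d)) + ⟪gu x, W x⟫ - u x * ⟪x, W x⟫)
      ∂(stdGauss d) = 0 := by
  have hd : ∀ x, HasFDerivAt (fun x => u x • W x)
      (u x • fderiv ℝ W x + (innerSL ℝ (gu x)).smulRight (W x)) x := fun x =>
    (hu x).smul (hW x).hasFDerivAt
  have hA0 : 0 ≤ A := (abs_nonneg _).trans (hA 0)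
  have hA0' : 0 ≤ A' := (norm_nonneg _).trans (hA' 0)
  have key := gdiv (fun x => u x • W x) (fun x => (hd x).differentiableAt) (A * B)
    (A * B' + A' * B)
    (fun x => by
      rw [norm_smul]
      gcongr
      · exact hA x
      · exact hB x)
    (fun x => by
      rw [(hd x).fderiv]
      refine (norm_add_le _ _).trans ?_
      rw [norm_smul, ContinuousLinearMap.norm_smulRight_apply, innerSL_apply_norm]
      gcongr
      · exact hA x
      · exact hB' x
      · exact hA' x
      · exact hB x)
  have e : ∀ x, LinearMap.trace ℝ (EuclideanSpace ℝ (Fin d)) (fderiv ℝ (fun x => u x • W x) x :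
      EuclideanSpace ℝ (Fin d) →ₗ[ℝ] EuclideanSpace ℝ (Fin d)) - ⟪x, u x • W x⟫ =
      u x * LinearMap.trace ℝ (EuclideanSpace ℝ (Fin d)) (fderiv ℝ W x :
      EuclideanSpace ℝ (Fin d) →ₗ[ℝ] EuclideanSpace ℝ (Fin d)) + ⟪gu x, W x⟫ - u x * ⟪x, W x⟫ := by
    intro x
    rw [(hd x).fderiv, inner_smul_right, ContinuousLinearMap.toLinearMap_add, map_add, trace_rank_one,
      ContinuousLinearMap.toLinearMap_smul, map_smul]
    rfl
  simp_rw [e] at key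
  exact key

structure FlowHyp (d : ℕ) (α : ℝ) (b : EuclideanSpace ℝ (Fin d) → EuclideanSpace ℝ (Fin d))
    (ρ : ℝ → EuclideanSpace ℝ (Fin d) → ℝ) (B : ℝ) : Prop where
  hα : 0 ≤ α
  hb : Differentiable ℝ b
  hB : ∀ x, ‖b x‖ ≤ B
  hB' : ∀ x, ‖fderiv ℝ b x‖ ≤ B
  hdiv : ∀ ξ, LinearMap.trace ℝ (EuclideanSpace ℝ (Fin d))
      (fderiv ℝ b ξ : EuclideanSpace ℝ (Fin d) →ₗ[ℝ] EuclideanSpace ℝ (Fin d)) = 0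
  horth : ∀ ξ, ⟪b ξ, ξ⟫ = 0
  nice : ∀ T > (0 : ℝ), ∃ ε C D, ∀ t ∈ Set.Icc 0 T, NiceFn d (ρ t) (gradient (ρ t)) ε C D ∧
    Differentiable ℝ (gradient (ρ t)) ∧ ∀ x, ‖fderiv ℝ (gradient (ρ t)) x‖ ≤ D
  tcont : ∀ ξ, ContinuousOn (fun t => ρ t ξ) (Set.Ici 0)
  hpde : ∀ t > (0 : ℝ), ∀ ξ, HasDerivAt (fun s => ρ s ξ)
      (⟪b ξ, gradient (ρ t) ξ⟫ + α * (lap d (ρ t) ξ - ⟪ξ, gradient (ρ t) ξ⟫)) t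

structure Psi (ψ ψ1 ψ2 : ℝ → ℝ) : Prop where
  h1 : ∀ r > 0, HasDerivAt ψ (ψ1 r) r
  h2 : ∀ r > 0, HasDerivAt ψ1 (ψ2 r) r
  h3 : ContinuousOn ψ2 (Set.Ioi 0)

lemma Psi.c0 {ψ ψ1 ψ2 : ℝ → ℝ} (h : Psi ψ ψ1 ψ2) : ContinuousOn ψ (Set.Ioi 0) :=
  fun r hr => (h.h1 r hr).continuousAt.continuousWithinAt

lemma Psi.c1 {ψ ψ1 ψ2 : ℝ → ℝ} (h : Psi ψ ψ1 ψ2) : ContinuousOn ψ1 (Set.Ioi 0) :=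
  fun r hr => (h.h2 r hr).continuousAt.continuousWithinAt

lemma bdd_on {ψ : ℝ → ℝ} (h : ContinuousOn ψ (Set.Ioi 0)) {ε : ℝ} (hε : 0 < ε) (C : ℝ) :
    ∃ A, 0 ≤ A ∧ ∀ r, ε ≤ r → r ≤ C → |ψ r| ≤ A := by
  obtain ⟨A, hA⟩ := (isCompact_Icc (a := ε) (b := C)).exists_bound_of_continuousOn
    (h.mono fun r hr => hε.trans_le hr.1)
  exact ⟨max A 0, le_max_right _ _, fun r h1 h2 => (hA r ⟨h1, h2⟩).trans (le_max_left _ _)⟩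

lemma comp_grad {d : ℕ} {f : EuclideanSpace ℝ (Fin d) → ℝ} {g x : EuclideanSpace ℝ (Fin d)}
    (hf : HasFDerivAt f (innerSL ℝ g) x) {ψ : ℝ → ℝ} {c : ℝ} (hψ : HasDerivAt ψ c (f x)) :
    HasFDerivAt (fun x => ψ (f x)) (innerSL ℝ (c • g)) x := by
  have := hψ.comp_hasFDerivAt x hf
  convert! this using 1
  ext v; simp

lemma ibp_main {d : ℕ} {α B ε C D : ℝ} {b : EuclideanSpace ℝ (Fin d) → EuclideanSpace ℝ (Fin d)}
    {ρ : ℝ → EuclideanSpace ℝ (Fin d) → ℝ} (F : FlowHyp d α b ρ B)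
    {f : EuclideanSpace ℝ (Fin d) → ℝ} (hn : NiceFn d f (gradient f) ε C D)
    (hg : Differentiable ℝ (gradient f)) (hg' : ∀ x, ‖fderiv ℝ (gradient f) x‖ ≤ D)
    {ψ ψ1 ψ2 : ℝ → ℝ} (hψ : Psi ψ ψ1 ψ2) :
    Integrable (fun x => ψ1 (f x) * (⟪b x, gradient f x⟫ + α * (lap d f x - ⟪x, gradient f x⟫)))
      (stdGauss d) ∧
    ∫ x, ψ1 (f x) * (⟪b x, gradient f x⟫ + α * (lap d f x - ⟪x, gradient f x⟫)) ∂(stdGauss d) =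
      -α * ∫ x, ψ2 (f x) * ‖gradient f x‖ ^ 2 ∂(stdGauss d) := by
  obtain ⟨A0, hA0, b0⟩ := bdd_on hψ.c0 hn.hε C
  obtain ⟨A1, hA1, b1⟩ := bdd_on hψ.c1 hn.hε C
  obtain ⟨A2, hA2, b2⟩ := bdd_on hψ.h3 hn.hε C
  have hD0 := hn.D_nonneg
  have k1 := gdiv_smul (fun x => ψ (f x)) (fun x => ψ1 (f x) • gradient f x) b
    (fun x => comp_grad (hn.hf x) (hψ.h1 _ (hn.pos x))) F.hb A0 (A1 * D) B B
    (fun x => b0 _ (hn.lo x) (hn.hi x))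
    (fun x => by
      rw [norm_smul]
      gcongr
      · exact b1 _ (hn.lo x) (hn.hi x)
      · exact hn.hD x) F.hB F.hB'
  have k2 := gdiv_smul (fun x => ψ1 (f x)) (fun x => ψ2 (f x) • gradient f x) (gradient f)
    (fun x => comp_grad (hn.hf x) (hψ.h2 _ (hn.pos x))) hg A1 (A2 * D) D D
    (fun x => b1 _ (hn.lo x) (hn.hi x))
    (fun x => by
      rw [norm_smul]
      gcongr
      · exact b2 _ (hn.lo x) (hn.hi x)
      · exact hn.hD x) hn.hD hg'
  have i3 : Integrable (fun x => ψ2 (f x) * ‖gradient f x‖ ^ 2) (stdGauss d) := by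
    have hgc := hn.hg
    refine integrable_of_bdd (Continuous.aestronglyMeasurable ?_) (A2 * D ^ 2) fun x => ?_
    · exact (hψ.h3.comp_continuous hn.cont fun x => hn.pos x).mul (by fun_prop)
    · rw [norm_mul, norm_pow, norm_norm]
      gcongr
      · exact b2 _ (hn.lo x) (hn.hi x)
      · exact hn.hD x
  have e : ∀ x, ψ1 (f x) * (⟪b x, gradient f x⟫ + α * (lap d f x - ⟪x, gradient f x⟫)) =
      (ψ (f x) * LinearMap.trace ℝ (EuclideanSpace ℝ (Fin d)) (fderiv ℝ b x :
      EuclideanSpace ℝ (Fin d) →ₗ[ℝ] EuclideanSpace ℝ (Fin d)) + ⟪ψ1 (f x) • gradient f x, b x⟫ -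
        ψ (f x) * ⟪x, b x⟫) + α * ((ψ1 (f x) * LinearMap.trace ℝ (EuclideanSpace ℝ (Fin d))
        (fderiv ℝ (gradient f) x :
      EuclideanSpace ℝ (Fin d) →ₗ[ℝ] EuclideanSpace ℝ (Fin d)) +
        ⟪ψ2 (f x) • gradient f x, gradient f x⟫ - ψ1 (f x) * ⟪x, gradient f x⟫) -
        ψ2 (f x) * ‖gradient f x‖ ^ 2) := by
    intro x
    rw [F.hdiv, real_inner_comm (b x) x, F.horth, real_inner_smul_left, real_inner_smul_left,
      real_inner_self_eq_norm_sq, real_inner_comm (b x)]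
    unfold lap
    ring
  simp_rw [e]
  refine ⟨k1.1.add ((k2.1.sub i3).const_mul α), ?_⟩
  have i4 := (k2.1.sub i3).const_mul α
  rw [integral_add k1.1 (by exact i4), k1.2, integral_const_mul, integral_sub k2.1 i3, k2.2]
  ring

section
variable {d : ℕ} {α B : ℝ} {b : EuclideanSpace ℝ (Fin d) → EuclideanSpace ℝ (Fin d)}
    {ρ : ℝ → EuclideanSpace ℝ (Fin d) → ℝ}

lemma flow_cont (F : FlowHyp d α b ρ B) {ψ ψ1 ψ2 : ℝ → ℝ} (hψ : Psi ψ ψ1 ψ2) :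
    ContinuousOn (fun t => ∫ x, ψ (ρ t x) ∂(stdGauss d)) (Set.Ici 0) := by
  intro t0 ht0
  have ht0' : (0 : ℝ) ≤ t0 := ht0
  obtain ⟨ε, C, D, hn⟩ := F.nice (t0 + 1) (by linarith)
  have hε := (hn 0 ⟨le_rfl, by linarith⟩).1.hε
  obtain ⟨A0, hA0, b0⟩ := bdd_on hψ.c0 hε C
  have ev : ∀ᶠ t in nhdsWithin t0 (Set.Ici 0), t ∈ Set.Icc 0 (t0 + 1) := by
    have h1 : ∀ᶠ t in nhdsWithin t0 (Set.Ici 0), t < t0 + 1 :=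
      nhdsWithin_le_nhds (Iio_mem_nhds (by linarith))
    filter_upwards [h1, self_mem_nhdsWithin] with t h1 h2
    exact ⟨h2, h1.le⟩
  refine continuousWithinAt_of_dominated (bound := fun _ => A0) ?_ ?_ (integrable_const _) ?_
  · filter_upwards [ev] with t ht
    exact (hψ.c0.comp_continuous (hn t ht).1.cont fun x => (hn t ht).1.pos x).aestronglyMeasurable
  · filter_upwards [ev] with t ht
    exact Filter.Eventually.of_forall fun x => b0 _ ((hn t ht).1.lo x) ((hn t ht).1.hi x)
  · refine Filter.Eventually.of_forall fun x => ?_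
    have hp := (hn t0 ⟨ht0, by linarith⟩).1.pos x
    exact (hψ.h1 _ hp).continuousAt.comp_continuousWithinAt (f := fun t => ρ t x) (F.tcont x t0 ht0)

lemma flow_deriv (F : FlowHyp d α b ρ B) {ψ ψ1 ψ2 : ℝ → ℝ} (hψ : Psi ψ ψ1 ψ2) (t0 : ℝ)
    (ht0 : 0 < t0) :
    HasDerivAt (fun t => ∫ x, ψ (ρ t x) ∂(stdGauss d))
      (-α * ∫ x, ψ2 (ρ t0 x) * ‖gradient (ρ t0) x‖ ^ 2 ∂(stdGauss d)) t0 := by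
  obtain ⟨ε, C, D, hn⟩ := F.nice (t0 + 1) (by linarith)
  have hε := (hn 0 ⟨le_rfl, by linarith⟩).1.hε
  have hD0 := (hn 0 ⟨le_rfl, by linarith⟩).1.D_nonneg
  obtain ⟨A0, hA0, b0⟩ := bdd_on hψ.c0 hε C
  obtain ⟨A1, hA1, b1⟩ := bdd_on hψ.c1 hε C
  have hB0 : 0 ≤ B := (norm_nonneg _).trans (F.hB 0)
  have hα := F.hα
  have hs : Set.Ioo 0 (t0 + 1) ∈ nhds t0 := Ioo_mem_nhds ht0 (by linarith)
  have ht : t0 ∈ Set.Icc 0 (t0 + 1) := ⟨ht0.le, by linarith⟩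
  have mc : ∀ t ∈ Set.Icc 0 (t0 + 1), AEStronglyMeasurable (fun x => ψ (ρ t x)) (stdGauss d) :=
    fun t ht =>
    (hψ.c0.comp_continuous (hn t ht).1.cont fun x => (hn t ht).1.pos x).aestronglyMeasurable
  obtain ⟨ii, ie⟩ := ibp_main F (hn t0 ht).1 (hn t0 ht).2.1 (hn t0 ht).2.2 hψ
  rw [← ie]
  refine (hasDerivAt_integral_of_dominated_loc_of_deriv_le (μ := stdGauss d) (𝕜 := ℝ)
    (F := fun t x => ψ (ρ t x))
    (F' := fun t x => ψ1 (ρ t x) * (⟪b x, gradient (ρ t) x⟫ +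
      α * (lap d (ρ t) x - ⟪x, gradient (ρ t) x⟫)))
    (bound := fun x => A1 * (B * D + α * (d * D + D * ‖x‖))) hs ?_
    (integrable_of_bdd (mc t0 ht) A0 fun x => b0 _ ((hn t0 ht).1.lo x) ((hn t0 ht).1.hi x))
    ii.1 ?_ ?_ ?_).2
  · filter_upwards [hs] with t ht
    exact mc t ⟨ht.1.le, ht.2.le⟩
  · refine Filter.Eventually.of_forall fun x t hts => ?_
    have ht : t ∈ Set.Icc 0 (t0 + 1) := ⟨hts.1.le, hts.2.le⟩
    have hN := (hn t ht).1
    rw [norm_mul]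
    gcongr
    · exact b1 _ (hN.lo x) (hN.hi x)
    · refine (norm_add_le _ _).trans ?_
      gcongr
      · refine (abs_real_inner_le_norm _ _).trans ?_
        gcongr
        · exact F.hB x
        · exact hN.hD x
      · rw [norm_mul, Real.norm_of_nonneg hα]
        gcongr
        refine (norm_sub_le _ _).trans ?_
        gcongr
        · refine (trace_le _).trans ?_
          gcongr
          exact (hn t ht).2.2 x
        · refine (abs_real_inner_le_norm _ _).trans ?_
          rw [mul_comm]
          gcongr
          exact hN.hD x
  · exact (((integrable_const _).add ((((integrable_const _).add
      ((integrable_norm_stdGauss d).const_mul D))).const_mul α))).const_mul A1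
  · refine Filter.Eventually.of_forall fun x t hts => ?_
    have ht : t ∈ Set.Icc 0 (t0 + 1) := ⟨hts.1.le, hts.2.le⟩
    exact (hψ.h1 _ ((hn t ht).1.pos x)).comp t (F.hpde t hts.1 x)

lemma psi_id : Psi (fun r => r) (fun _ => 1) (fun _ => 0) :=
  ⟨fun r _ => hasDerivAt_id r, fun r _ => hasDerivAt_const r 1, continuousOn_const⟩

lemma psi_log : Psi (fun r => r * Real.log r) (fun r => Real.log r + 1) (fun r => r⁻¹) :=
  ⟨fun r hr => Real.hasDerivAt_mul_log (ne_of_gt hr),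
   fun r hr => (Real.hasDerivAt_log (ne_of_gt hr)).add_const 1,
   continuousOn_inv₀.mono fun r hr => ne_of_gt hr⟩

lemma mass_const (F : FlowHyp d α b ρ B) (t : ℝ) (ht : 0 ≤ t) :
    ∫ x, ρ t x ∂(stdGauss d) = ∫ x, ρ 0 x ∂(stdGauss d) := by
  have hc := flow_cont F psi_id
  have hd : ∀ t > 0, HasDerivAt (fun t => ∫ x, ρ t x ∂(stdGauss d)) 0 t := fun t ht => by
    simpa using flow_deriv F psi_id t ht
  have m1 := monotoneOn_of_deriv_nonneg (convex_Ici (0 : ℝ)) hc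
    (fun s hs => (hd s (by simpa using hs)).differentiableAt.differentiableWithinAt)
    (fun s hs => (hd s (by simpa using hs)).deriv.ge)
  have m2 := antitoneOn_of_deriv_nonpos (convex_Ici (0 : ℝ)) hc
    (fun s hs => (hd s (by simpa using hs)).differentiableAt.differentiableWithinAt)
    (fun s hs => (hd s (by simpa using hs)).deriv.le)
  exact le_antisymm (m2 Set.self_mem_Ici ht ht) (m1 Set.self_mem_Ici ht ht)

lemma flow_main (F : FlowHyp d α b ρ B) (t : ℝ) (ht : 0 ≤ t) :
      ∫ ξ, ρ t ξ * Real.log (ρ t ξ) ∂(stdGauss d) ≤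
        Real.exp (-2 * α * t) * ∫ ξ, ρ 0 ξ * Real.log (ρ 0 ξ) ∂(stdGauss d) +
        (1 - Real.exp (-2 * α * t)) * (∫ ξ, ρ 0 ξ ∂(stdGauss d)) *
          Real.log (∫ ξ, ρ 0 ξ ∂(stdGauss d)) := by
  set m := ∫ ξ, ρ 0 ξ ∂(stdGauss d) with hm
  set H : ℝ → ℝ := fun t => ∫ ξ, ρ t ξ * Real.log (ρ t ξ) ∂(stdGauss d) with hH
  have hc : ContinuousOn H (Set.Ici 0) := flow_cont F psi_log
  have hE : ∀ t, HasDerivAt (fun t => Real.exp (2 * α * t)) (Real.exp (2 * α * t) * (2 * α)) t := by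
    intro t
    simpa using ((hasDerivAt_id t).const_mul (2 * α)).exp
  have hd : ∀ t > 0, HasDerivAt (fun t => Real.exp (2 * α * t) * (H t - m * Real.log m))
      (Real.exp (2 * α * t) * (2 * α) * (H t - m * Real.log m) + Real.exp (2 * α * t) *
        (-α * ∫ x, (ρ t x)⁻¹ * ‖gradient (ρ t) x‖ ^ 2 ∂(stdGauss d))) t := fun t ht =>
    (hE t).mul ((flow_deriv F psi_log t ht).sub_const _)
  have m2 := antitoneOn_of_deriv_nonpos (convex_Ici (0 : ℝ))
    (f := fun t => Real.exp (2 * α * t) * (H t - m * Real.log m))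
    (ContinuousOn.mul (by fun_prop) (hc.sub continuousOn_const))
    (fun s hs => (hd s (by simpa using hs)).differentiableAt.differentiableWithinAt)
    (fun s hs => by
      have hs' : 0 < s := by simpa using hs
      rw [(hd s hs').deriv]
      obtain ⟨ε, C, D, hn⟩ := F.nice s hs'
      have l := (hn s ⟨hs'.le, le_rfl⟩).1.lsi
      rw [mass_const F s hs'.le, ← hm] at l
      have e : ∫ x, (ρ s x)⁻¹ * ‖gradient (ρ s) x‖ ^ 2 ∂(stdGauss d) =
          ∫ x, ‖gradient (ρ s) x‖ ^ 2 / ρ s x ∂(stdGauss d) := by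
        congr 1; ext x; rw [div_eq_inv_mul]
      rw [e]
      have hl : H s - m * Real.log m - (1 / 2) *
        ∫ x, ‖gradient (ρ s) x‖ ^ 2 / ρ s x ∂(stdGauss d) ≤ 0 := by
        simp only [hH]; linarith
      have := mul_nonpos_of_nonneg_of_nonpos
        (mul_nonneg (Real.exp_pos (2 * α * s)).le (mul_nonneg zero_le_two F.hα)) hl
      linarith)
  have fin := m2 Set.self_mem_Ici ht ht
  simp only [mul_zero, Real.exp_zero, one_mul] at fin
  have hx : Real.exp (-2 * α * t) * Real.exp (2 * α * t) = 1 := by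
    rw [← Real.exp_add]; simp
  have := mul_le_mul_of_nonneg_left fin (Real.exp_pos (-2 * α * t)).le
  rw [← mul_assoc, hx] at this
  change H t ≤ Real.exp (-2 * α * t) * H 0 + _
  linarith

end

end Aux

theorem stmt7 (d : ℕ) (α : ℝ) (hα : 0 ≤ α)
    (b : EuclideanSpace ℝ (Fin d) → EuclideanSpace ℝ (Fin d))
    (hbsmooth : ContDiff ℝ (⊤ : ℕ∞) b) (hbsupp : HasCompactSupport b)
    (hdiv : ∀ ξ, LinearMap.trace ℝ (EuclideanSpace ℝ (Fin d))
      (fderiv ℝ b ξ : EuclideanSpace ℝ (Fin d) →ₗ[ℝ] EuclideanSpace ℝ (Fin d)) = 0)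
    (horth : ∀ ξ, ⟪b ξ, ξ⟫ = 0)
    (ρ : ℝ → EuclideanSpace ℝ (Fin d) → ℝ)
    (hbd : ∃ C, ∀ t ≥ (0 : ℝ), ∀ ξ, |ρ t ξ| ≤ C)
    (htreg : ∀ ξ, ContDiffOn ℝ 1 (fun t => ρ t ξ) (Set.Ici 0))
    (hxreg : ∀ t ≥ (0 : ℝ), ContDiff ℝ 2 (ρ t))
    (hxbd : ∃ C, ∀ t ≥ (0 : ℝ), ∀ ξ, ‖iteratedFDeriv ℝ 1 (ρ t) ξ‖ ≤ C ∧
      ‖iteratedFDeriv ℝ 2 (ρ t) ξ‖ ≤ C)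
    (hinf : ∀ T > (0 : ℝ), ∃ ε > (0 : ℝ), ∀ t ∈ Set.Icc (0 : ℝ) T, ∀ ξ, ε ≤ ρ t ξ)
    (hpde : ∀ t > (0 : ℝ), ∀ ξ, HasDerivAt (fun s => ρ s ξ)
      (⟪b ξ, gradient (ρ t) ξ⟫ + α * (lap d (ρ t) ξ - ⟪ξ, gradient (ρ t) ξ⟫)) t) :
    ∀ t ≥ (0 : ℝ),
      ∫ ξ, ρ t ξ * Real.log (ρ t ξ) ∂(stdGauss d) ≤
        Real.exp (-2 * α * t) * ∫ ξ, ρ 0 ξ * Real.log (ρ 0 ξ) ∂(stdGauss d) +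
        (1 - Real.exp (-2 * α * t)) * (∫ ξ, ρ 0 ξ ∂(stdGauss d)) *
          Real.log (∫ ξ, ρ 0 ξ ∂(stdGauss d)) := by
  obtain ⟨C, hC⟩ := hbd
  obtain ⟨D, hD⟩ := hxbd
  have hb1 : Continuous (fderiv ℝ b) := hbsmooth.continuous_fderiv (by simp)
  obtain ⟨B1, hB1⟩ := hbsupp.exists_bound_of_continuous hbsmooth.continuous
  obtain ⟨B2, hB2⟩ := (hbsupp.fderiv (𝕜 := ℝ)).exists_bound_of_continuous hb1
  have F : FlowHyp d α b ρ (max B1 B2) := by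
    refine ⟨hα, hbsmooth.differentiable (by simp), fun x => (hB1 x).trans (le_max_left _ _),
      fun x => (hB2 x).trans (le_max_right _ _), hdiv, horth, fun T hT => ?_,
      fun ξ => (htreg ξ).continuousOn, hpde⟩
    obtain ⟨ε, hε, hlo⟩ := hinf T hT
    refine ⟨ε, C, D, fun t ht => ?_⟩
    have h2 := hxreg t ht.1
    have h1 : ContDiff ℝ 1 (fderiv ℝ (ρ t)) := h2.fderiv_right (by norm_num)
    obtain ⟨T', hT'⟩ : ∃ T' : (EuclideanSpace ℝ (Fin d) →L[ℝ] ℝ) →L[ℝ] EuclideanSpace ℝ (Fin d),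
        ∀ L, T' L = (InnerProductSpace.toDual ℝ (EuclideanSpace ℝ (Fin d))).symm L :=
      ⟨LinearMap.mkContinuous
        { toFun := fun L => (InnerProductSpace.toDual ℝ (EuclideanSpace ℝ (Fin d))).symm L
          map_add' := by intro x y; simp
          map_smul' := by intro c x; simp } 1 (by intro x; simp), fun L => rfl⟩
    have hgr : gradient (ρ t) = fun x => T' (fderiv ℝ (ρ t) x) := by
      funext x
      rw [hT']
      rfl
    have hgd : ∀ x, HasFDerivAt (gradient (ρ t))
        (T'.comp (fderiv ℝ (fderiv ℝ (ρ t)) x)) x := fun x => by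
      rw [hgr]
      exact T'.hasFDerivAt.comp x (h1.differentiable (by simp) x).hasFDerivAt
    refine ⟨⟨hε, hlo t ht, fun x => (le_abs_self _).trans (hC t ht.1 x), fun x => ?_, ?_, fun x => ?_⟩,
      fun x => (hgd x).differentiableAt, fun x => ?_⟩
    · exact (h2.differentiable (by simp) x).hasGradientAt.hasFDerivAt
    · rw [hgr]
      exact T'.continuous.comp h1.continuous
    · have := (hD t ht.1 x).1
      rw [norm_iteratedFDeriv_one] at this
      simpa [gradient] using this
    · have := (hD t ht.1 x).2
      rw [← norm_iteratedFDeriv_fderiv, norm_iteratedFDeriv_one] at this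
      rw [(hgd x).fderiv]
      refine (ContinuousLinearMap.opNorm_le_bound _ (norm_nonneg _) fun v => ?_).trans this
      rw [ContinuousLinearMap.comp_apply, hT', LinearIsometryEquiv.norm_map]
      exact (fderiv ℝ (fderiv ℝ (ρ t)) x).le_opNorm v
  exact fun t ht => flow_main F t ht
end

section
/- Under the stated assumptions on b and ρ, the variance with respect to the standard Gaussian measure μ decays exponentially: for every t ≥ 0, ∫_{ℝ^d} (ρ(t,·) − m)² dμ ≤ e^{−2αt} ∫_{ℝ^d} (ρ(0,·) − m)² dμ, where m = ∫_{ℝ^d} ρ(0,·) dμ. -/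
open MeasureTheory Real RealInnerProductSpace

section helpers
open ProbabilityTheory

/-- Gaussian density. -/
noncomputable def gDens (d : ℕ) (ξ : EuclideanSpace ℝ (Fin d)) : ℝ :=
  (2 * π) ^ (-(d : ℝ) / 2) * Real.exp (-‖ξ‖ ^ 2 / 2)

lemma gDens_nonneg (d : ℕ) (ξ : EuclideanSpace ℝ (Fin d)) : 0 ≤ gDens d ξ := by
  unfold gDens; positivity

lemma gDens_cont (d : ℕ) : Continuous (gDens d) := by
  unfold gDens; fun_prop

lemma gDens_integrable (d : ℕ) : Integrable (gDens d) := by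
  unfold gDens
  apply Integrable.const_mul
  have h := GaussianFourier.integrable_cexp_neg_mul_sq_norm_add (b := (1/2 : ℂ))
    (by norm_num) 0 (0 : EuclideanSpace ℝ (Fin d))
  have h2 := h.norm
  refine h2.congr (Filter.Eventually.of_forall fun x => ?_)
  simp only [Complex.norm_exp]
  congr 1
  simp
  norm_cast
  ring

lemma stdGauss_eq' (d : ℕ) : stdGauss d = volume.withDensity fun ξ => ENNReal.ofReal (gDens d ξ) := rfl

instance stdGauss_fin (d : ℕ) : IsFiniteMeasure (stdGauss d) := by
  rw [stdGauss_eq']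
  exact isFiniteMeasure_withDensity_ofReal (gDens_integrable d).2

lemma stdGauss_integral {F : Type*} [NormedAddCommGroup F] [NormedSpace ℝ F] (d : ℕ)
    (f : EuclideanSpace ℝ (Fin d) → F) :
    ∫ x, f x ∂(stdGauss d) = ∫ x, gDens d x • f x := by
  rw [stdGauss_eq', integral_withDensity_eq_integral_toReal_smul]
  · simp [ENNReal.toReal_ofReal, gDens_nonneg]
  · exact (gDens_cont d).measurable.ennreal_ofReal
  · simp

lemma stdGauss_integrable_iff {F : Type*} [NormedAddCommGroup F] [NormedSpace ℝ F] (d : ℕ)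
    (f : EuclideanSpace ℝ (Fin d) → F) :
    Integrable f (stdGauss d) ↔ Integrable (fun x => gDens d x • f x) := by
  rw [stdGauss_eq', integrable_withDensity_iff_integrable_smul']
  · simp [ENNReal.toReal_ofReal, gDens_nonneg]
  · exact (gDens_cont d).measurable.ennreal_ofReal
  · simp

instance stdGauss_prob (d : ℕ) : IsProbabilityMeasure (stdGauss d) := by
  rw [stdGauss_eq]; infer_instance

lemma stdGauss_norm_integrable (d : ℕ) :
    Integrable (fun x : EuclideanSpace ℝ (Fin d) => ‖x‖) (stdGauss d) := by
  rw [stdGauss_eq]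
  have := (IsGaussian.memLp_id (stdGaussian (EuclideanSpace ℝ (Fin d))) 1 (by simp)).integrable le_rfl
  exact this.norm

lemma stdGauss_rot_s9 (d : ℕ) (c s : ℝ) (h : c ^ 2 + s ^ 2 = 1) :
    ((stdGauss d).prod (stdGauss d)).map (fun p => c • p.1 + s • p.2) = stdGauss d := by
  have h0 : ((stdGauss d).prod (stdGauss d)).map (fun p => c • p.1 + s • p.2)
    = ((stdGauss d).map (fun x => c • x)) ∗ ((stdGauss d).map (fun x => s • x)) := by
    rw [Measure.conv, Measure.map_prod_map _ _ (by fun_prop) (by fun_prop),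
      Measure.map_map (by fun_prop) (by fun_prop)]
    rfl
  rw [h0]
  apply Measure.ext_of_charFun
  ext t
  rw [charFun_conv, charFun_map_smul, charFun_map_smul, stdGauss_eq]
  simp only [charFun_stdGaussian, ← Complex.exp_add, norm_smul]
  congr 1
  push_cast
  simp only [mul_pow, ← Complex.ofReal_pow, Real.norm_eq_abs, sq_abs]
  rw [← sub_eq_zero]
  have : ((c^2 + s^2 : ℝ) : ℂ) = 1 := by rw [h]; simp
  push_cast at this ⊢
  linear_combination (-(‖t‖ : ℂ)^2/2) * this

lemma gDens_hasFDerivAt (d : ℕ) (x : EuclideanSpace ℝ (Fin d)) :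
    HasFDerivAt (gDens d) (-(gDens d x) • innerSL ℝ x) x := by
  unfold gDens
  have h1 : HasFDerivAt (fun x : EuclideanSpace ℝ (Fin d) => ‖x‖ ^ 2) (2 • innerSL ℝ x) x :=
    (hasStrictFDerivAt_norm_sq x).hasFDerivAt
  have h2 := ((h1.neg.mul_const (1/2:ℝ)).exp).const_mul ((2 * π) ^ (-(d : ℝ) / 2))
  convert! h2 using 1
  · ext y; simp [div_eq_mul_inv]
  · ext y; simp; ring_nf

/-- Gaussian integration by parts for bounded C¹ vector fields. -/
lemma gauss_ibp (d : ℕ) (F : EuclideanSpace ℝ (Fin d) → EuclideanSpace ℝ (Fin d)) (C : ℝ)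
    (hF : ContDiff ℝ 1 F) (hb : ∀ x, ‖F x‖ ≤ C) (hb' : ∀ x, ‖fderiv ℝ F x‖ ≤ C) :
    ∫ x, (LinearMap.trace ℝ (EuclideanSpace ℝ (Fin d))
      (fderiv ℝ F x : EuclideanSpace ℝ (Fin d) →ₗ[ℝ] EuclideanSpace ℝ (Fin d)) - ⟪x, F x⟫)
      ∂(stdGauss d) = 0 := by
  set e := EuclideanSpace.basisFun (Fin d) ℝ
  have hFc : Continuous F := hF.continuous
  have hF'c : Continuous (fderiv ℝ F) := hF.continuous_fderiv (by norm_num)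
  have key : ∀ i, Integrable (fun x => ⟪e i, fderiv ℝ F x (e i)⟫ - ⟪x, e i⟫ * ⟪e i, F x⟫) (stdGauss d) ∧
      ∫ x, (⟪e i, fderiv ℝ F x (e i)⟫ - ⟪x, e i⟫ * ⟪e i, F x⟫) ∂(stdGauss d) = 0 := by
    intro i
    have hei : ‖e i‖ = 1 := e.orthonormal.1 i
    have hf : ∀ x, HasFDerivAt (fun x => ⟪e i, F x⟫) ((innerSL ℝ (e i)).comp (fderiv ℝ F x)) x := by
      intro x
      exact (innerSL ℝ (e i)).hasFDerivAt.comp x (hF.differentiable (by norm_num) x).hasFDerivAt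
    have i1 : Integrable (fun x => ⟪e i, fderiv ℝ F x (e i)⟫) (stdGauss d) := by
      apply Integrable.of_bound (C := C)
      · exact (by fun_prop : Continuous (fun x => ⟪e i, fderiv ℝ F x (e i)⟫)).aestronglyMeasurable
      · refine Filter.Eventually.of_forall fun x => ?_
        calc _ ≤ ‖e i‖ * ‖fderiv ℝ F x (e i)‖ := norm_inner_le_norm _ _
          _ ≤ ‖e i‖ * (‖fderiv ℝ F x‖ * ‖e i‖) := by gcongr; exact ContinuousLinearMap.le_opNorm _ _
          _ ≤ C := by rw [hei]; simpa using hb' x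
    have i2 : Integrable (fun x => ⟪e i, F x⟫) (stdGauss d) := by
      apply Integrable.of_bound (C := C)
      · exact (by fun_prop : Continuous (fun x => ⟪e i, F x⟫)).aestronglyMeasurable
      · refine Filter.Eventually.of_forall fun x => ?_
        calc _ ≤ ‖e i‖ * ‖F x‖ := norm_inner_le_norm _ _
          _ ≤ C := by rw [hei]; simpa using hb x
    have i3 : Integrable (fun x => ⟪x, e i⟫ * ⟪e i, F x⟫) (stdGauss d) := by
      refine ((stdGauss_norm_integrable d).mul_const C).mono'
        (by fun_prop : Continuous (fun x => ⟪x, e i⟫ * ⟪e i, F x⟫)).aestronglyMeasurable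
        (Filter.Eventually.of_forall fun x => ?_)
      rw [norm_mul]
      have a1 : ‖⟪x, e i⟫‖ ≤ ‖x‖ := by simpa [hei] using norm_inner_le_norm (𝕜 := ℝ) x (e i)
      have a2 : ‖⟪e i, F x⟫‖ ≤ C := by
        have := norm_inner_le_norm (𝕜 := ℝ) (e i) (F x)
        rw [hei, one_mul] at this
        exact this.trans (hb x)
      gcongr
    refine ⟨i1.sub i3, ?_⟩
    have hib := integral_mul_fderiv_eq_neg_fderiv_mul_of_integrable (𝕜 := ℝ)
      (μ := (volume : Measure (EuclideanSpace ℝ (Fin d))))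
      (f := gDens d) (g := fun x => ⟪e i, F x⟫) (v := e i) ?_ ?_ ?_ ?_ ?_
    · rw [integral_sub i1 i3, stdGauss_integral, stdGauss_integral]
      simp only [(gDens_hasFDerivAt d _).fderiv, (hf _).fderiv] at hib
      simp only [smul_eq_mul]
      simp at hib
      rw [hib, ← integral_neg, sub_eq_zero]
      congr 1
      ext x
      ring
    · simp only [(gDens_hasFDerivAt d _).fderiv]
      have := ((stdGauss_integrable_iff d _).1 i3).neg
      refine this.congr (Filter.Eventually.of_forall fun x => ?_)
      simp; ring
    · simp only [(hf _).fderiv]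
      exact (stdGauss_integrable_iff d _).1 i1
    · exact (stdGauss_integrable_iff d _).1 i2
    · exact fun x _ => (gDens_hasFDerivAt d x).differentiableAt
    · exact fun x _ => (hf x).differentiableAt
  have : ∀ x, LinearMap.trace ℝ (EuclideanSpace ℝ (Fin d))
      (fderiv ℝ F x : EuclideanSpace ℝ (Fin d) →ₗ[ℝ] EuclideanSpace ℝ (Fin d)) - ⟪x, F x⟫
      = ∑ i, (⟪e i, fderiv ℝ F x (e i)⟫ - ⟪x, e i⟫ * ⟪e i, F x⟫) := by
    intro x
    rw [LinearMap.trace_eq_sum_inner _ e, Finset.sum_sub_distrib, e.sum_inner_mul_inner]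
    rfl
  simp_rw [this]
  rw [integral_finsetSum _ (fun i _ => (key i).1)]
  exact Finset.sum_eq_zero fun i _ => (key i).2

lemma integrable_lin (d : ℕ) (h : EuclideanSpace ℝ (Fin d) → ℝ) (A : ℝ) (hc : Continuous h)
    (hb : ∀ x, |h x| ≤ A * (1 + ‖x‖)) : Integrable h (stdGauss d) := by
  refine Integrable.mono' (((integrable_const 1).add (stdGauss_norm_integrable d)).const_mul A)
    hc.aestronglyMeasurable (Filter.Eventually.of_forall fun x => hb x)

lemma lin_integrable2 (d : ℕ) :
    Integrable (fun p : EuclideanSpace ℝ (Fin d) × EuclideanSpace ℝ (Fin d) => 1 + ‖p.1‖ + ‖p.2‖)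
      ((stdGauss d).prod (stdGauss d)) :=
  ((integrable_const 1).add ((stdGauss_norm_integrable d).comp_fst _)).add
      ((stdGauss_norm_integrable d).comp_snd _)

lemma integrable_lin2 (d : ℕ) (h : EuclideanSpace ℝ (Fin d) × EuclideanSpace ℝ (Fin d) → ℝ)
    (A : ℝ) (hc : Continuous h)
    (hb : ∀ x, |h x| ≤ A * (1 + ‖x.1‖ + ‖x.2‖)) :
    Integrable h ((stdGauss d).prod (stdGauss d)) :=
  Integrable.mono' ((lin_integrable2 d).const_mul A)
    hc.aestronglyMeasurable (Filter.Eventually.of_forall fun x => hb x)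

/-- trace of a continuous linear endomorphism -/
noncomputable def tr (d : ℕ) (A : EuclideanSpace ℝ (Fin d) →L[ℝ] EuclideanSpace ℝ (Fin d)) : ℝ :=
  LinearMap.trace ℝ (EuclideanSpace ℝ (Fin d))
      (A : EuclideanSpace ℝ (Fin d) →ₗ[ℝ] EuclideanSpace ℝ (Fin d))

lemma tr_eq (d : ℕ) (A : EuclideanSpace ℝ (Fin d) →L[ℝ] EuclideanSpace ℝ (Fin d)) :
    tr d A = ∑ i, ⟪EuclideanSpace.basisFun (Fin d) ℝ i, A (EuclideanSpace.basisFun (Fin d) ℝ i)⟫ := by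
  rw [tr, LinearMap.trace_eq_sum_inner _ (EuclideanSpace.basisFun (Fin d) ℝ)]
  rfl

lemma tr_cont (d : ℕ) : Continuous (tr d) := by
  have : tr d = fun A => ∑ i, ⟪EuclideanSpace.basisFun (Fin d) ℝ i, A (EuclideanSpace.basisFun (Fin d) ℝ i)⟫ :=
    funext (tr_eq d)
  rw [this]
  fun_prop

lemma tr_bound (d : ℕ) (A : EuclideanSpace ℝ (Fin d) →L[ℝ] EuclideanSpace ℝ (Fin d)) :
    |tr d A| ≤ d * ‖A‖ := by
  rw [tr_eq]
  refine (Finset.abs_sum_le_sum_abs _ _).trans ?_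
  refine (Finset.sum_le_card_nsmul _ _ ‖A‖ fun i _ => ?_).trans (by simp)
  have hei : ‖EuclideanSpace.basisFun (Fin d) ℝ i‖ = 1 :=
    (EuclideanSpace.basisFun (Fin d) ℝ).orthonormal.1 i
  refine (abs_real_inner_le_norm _ _).trans ?_
  rw [hei, one_mul]
  simpa [hei] using A.le_opNorm (EuclideanSpace.basisFun (Fin d) ℝ i)

lemma tr_add (d : ℕ) (A B : EuclideanSpace ℝ (Fin d) →L[ℝ] EuclideanSpace ℝ (Fin d)) :
    tr d (A + B) = tr d A + tr d B := by simp [tr]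

lemma tr_smul (d : ℕ) (c : ℝ) (A : EuclideanSpace ℝ (Fin d) →L[ℝ] EuclideanSpace ℝ (Fin d)) :
    tr d (c • A) = c * tr d A := by simp [tr]

lemma tr_smulRight (d : ℕ) (L : EuclideanSpace ℝ (Fin d) →L[ℝ] ℝ) (v : EuclideanSpace ℝ (Fin d)) :
    tr d (L.smulRight v) = L v := by
  rw [tr_eq]
  conv_rhs => rw [← (EuclideanSpace.basisFun (Fin d) ℝ).sum_repr' v]
  rw [map_sum]
  refine Finset.sum_congr rfl fun i _ => ?_
  rw [ContinuousLinearMap.smulRight_apply, inner_smul_right, map_smul, smul_eq_mul, mul_comm]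

/-- IBP with a scalar weight. -/
lemma gauss_ibp2 (d : ℕ) (G : EuclideanSpace ℝ (Fin d) → EuclideanSpace ℝ (Fin d))
    (g : EuclideanSpace ℝ (Fin d) → ℝ) (C C' : ℝ)
    (hg : ContDiff ℝ 1 g) (hgb : ∀ x, |g x| ≤ C') (hgb' : ∀ x, ‖fderiv ℝ g x‖ ≤ C')
    (hG : ContDiff ℝ 1 G) (hb : ∀ x, ‖G x‖ ≤ C) (hb' : ∀ x, ‖fderiv ℝ G x‖ ≤ C) :
    ∫ x, (fderiv ℝ g x (G x) + g x * (tr d (fderiv ℝ G x) - ⟪x, G x⟫)) ∂(stdGauss d) = 0 := by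
  have hC : 0 ≤ C := (norm_nonneg _).trans (hb 0)
  have hC' : 0 ≤ C' := (norm_nonneg _).trans (hgb' 0)
  have hd : ∀ x, fderiv ℝ (fun x => g x • G x) x = g x • fderiv ℝ G x + (fderiv ℝ g x).smulRight (G x) := by
    intro x
    exact (((hg.differentiable (by norm_num) x).hasFDerivAt).smul
      ((hG.differentiable (by norm_num) x).hasFDerivAt)).fderiv
  have := gauss_ibp d (fun x => g x • G x) (2 * (C' * C)) (hg.smul hG) ?_ ?_
  · rw [← this]
    congr 1
    ext x
    change _ = tr d _ - _
    rw [hd, tr_add, tr_smul, tr_smulRight, inner_smul_right]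
    ring
  · intro x
    rw [norm_smul]
    have : ‖g x‖ * ‖G x‖ ≤ C' * C := by gcongr; exacts [hgb x, hb x]
    nlinarith [mul_nonneg hC' hC]
  · intro x
    rw [hd]
    refine (norm_add_le _ _).trans ?_
    rw [norm_smul, ContinuousLinearMap.norm_smulRight_apply]
    have h1 : ‖g x‖ * ‖fderiv ℝ G x‖ ≤ C' * C := by gcongr; exacts [hgb x, hb' x]
    have h2 : ‖fderiv ℝ g x‖ * ‖G x‖ ≤ C' * C := by gcongr; exacts [hgb' x, hb x]
    linarith

/-- bounded C² functions with bounded derivatives -/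
structure Nice (d : ℕ) (f : EuclideanSpace ℝ (Fin d) → ℝ) (C : ℝ) : Prop where
  cd : ContDiff ℝ 2 f
  b0 : ∀ x, |f x| ≤ C
  b1 : ∀ x, ‖fderiv ℝ f x‖ ≤ C
  g1 : ContDiff ℝ 1 (gradient f)
  b1' : ∀ x, ‖gradient f x‖ ≤ C
  b2 : ∀ x, ‖fderiv ℝ (gradient f) x‖ ≤ C

lemma nice_mk (d : ℕ) (f : EuclideanSpace ℝ (Fin d) → ℝ) (C C' : ℝ)
    (hf : ContDiff ℝ 2 f) (h0 : ∀ x, |f x| ≤ C)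
    (h1 : ∀ x, ‖iteratedFDeriv ℝ 1 f x‖ ≤ C' ∧ ‖iteratedFDeriv ℝ 2 f x‖ ≤ C') :
    Nice d f (max C C') := by
  have e : gradient f = fun x => (InnerProductSpace.toDual ℝ (EuclideanSpace ℝ (Fin d))).symm (fderiv ℝ f x) := rfl
  have hb1 : ∀ x, ‖fderiv ℝ f x‖ ≤ C' := by
    intro x
    rw [← norm_iteratedFDeriv_one]
    exact (h1 x).1
  have hfd : ContDiff ℝ 1 (fderiv ℝ f) := hf.fderiv_right (by norm_num)
  have hg : ContDiff ℝ 1 (gradient f) := by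
    rw [e]
    exact ((InnerProductSpace.toDual ℝ (EuclideanSpace ℝ (Fin d))).symm.contDiff).comp hfd
  refine ⟨hf, fun x => (h0 x).trans (le_max_left _ _), fun x => (hb1 x).trans (le_max_right _ _), hg,
    fun x => ?_, fun x => ?_⟩
  · rw [e, LinearIsometryEquiv.norm_map]
    exact (hb1 x).trans (le_max_right _ _)
  · have h2 : ‖fderiv ℝ (fderiv ℝ f) x‖ ≤ C' := by
      rw [← norm_iteratedFDeriv_one, norm_iteratedFDeriv_fderiv]
      exact (h1 x).2
    refine le_trans ?_ (h2.trans (le_max_right _ _))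
    have : HasFDerivAt (gradient f) _ x :=
      ((InnerProductSpace.toDual ℝ (EuclideanSpace ℝ (Fin d))).symm.hasFDerivAt).comp x
      (hfd.differentiable (by norm_num) x).hasFDerivAt
    rw [this.fderiv]
    refine ContinuousLinearMap.opNorm_le_bound _ (ContinuousLinearMap.opNorm_nonneg _) fun y => ?_
    simp only [ContinuousLinearMap.comp_apply]
    erw [LinearIsometryEquiv.norm_map]
    exact ContinuousLinearMap.le_opNorm _ _

lemma fderiv_eq_inner (d : ℕ) (f : EuclideanSpace ℝ (Fin d) → ℝ) (x v : EuclideanSpace ℝ (Fin d)) :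
    fderiv ℝ f x v = ⟪v, gradient f x⟫ := by
  rw [real_inner_comm, gradient, InnerProductSpace.toDual_symm_apply]

lemma lap_eq (d : ℕ) (f : EuclideanSpace ℝ (Fin d) → ℝ) (x : EuclideanSpace ℝ (Fin d)) :
    lap d f x = tr d (fderiv ℝ (gradient f) x) := rfl

lemma poincare_deriv (d : ℕ) (f : EuclideanSpace ℝ (Fin d) → ℝ) (C : ℝ) (hf : Nice d f C)
    (c s : ℝ) :
    ∫ p : EuclideanSpace ℝ (Fin d) × EuclideanSpace ℝ (Fin d),
      f p.1 * ⟪-s • p.1 + c • p.2, gradient f (c • p.1 + s • p.2)⟫ ∂((stdGauss d).prod (stdGauss d))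
    = -s * ∫ p : EuclideanSpace ℝ (Fin d) × EuclideanSpace ℝ (Fin d),
      ⟪gradient f p.1, gradient f (c • p.1 + s • p.2)⟫ ∂((stdGauss d).prod (stdGauss d)) := by
  have hC : 0 ≤ C := (norm_nonneg _).trans (hf.b1 0)
  have cf : Continuous f := hf.cd.continuous
  have cg : Continuous (gradient f) := hf.g1.continuous
  have cl : Continuous (fun x => tr d (fderiv ℝ (gradient f) x)) :=
    (tr_cont d).comp (hf.g1.continuous_fderiv (by norm_num))
  have bl : ∀ x, |tr d (fderiv ℝ (gradient f) x)| ≤ d * C := fun x =>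
    (tr_bound d _).trans (by gcongr; exact hf.b2 x)
  -- derivative of the composed fields
  have comp : ∀ (k : ℝ) (w x : EuclideanSpace ℝ (Fin d)),
      fderiv ℝ (fun x => gradient f (k • x + w)) x = k • fderiv ℝ (gradient f) (k • x + w) := by
    intro k w x
    have h1 : HasFDerivAt (fun x : EuclideanSpace ℝ (Fin d) => k • x + w)
      (k • ContinuousLinearMap.id ℝ (EuclideanSpace ℝ (Fin d))) x :=
      ((hasFDerivAt_id x).const_smul k).add_const w
    have h2 := (hf.g1.differentiable (by norm_num) (k • x + w)).hasFDerivAt.comp x h1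
    refine h2.fderiv.trans ?_
    ext1 y
    simp
  have compC : ∀ (k : ℝ) (w : EuclideanSpace ℝ (Fin d)),
      ContDiff ℝ 1 (fun x => gradient f (k • x + w)) := by
    intro k w
    exact hf.g1.comp (by fun_prop)
  have compB : ∀ (k : ℝ) (w x : EuclideanSpace ℝ (Fin d)),
      ‖fderiv ℝ (fun x => gradient f (k • x + w)) x‖ ≤ (1 + |k|) * C := by
    intro k w x
    rw [comp, norm_smul, Real.norm_eq_abs]
    have := hf.b2 (k • x + w)
    have : |k| * ‖fderiv ℝ (gradient f) (k • x + w)‖ ≤ |k| * C := by gcongr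
    linarith
  have compB0 : ∀ (k : ℝ) (w x : EuclideanSpace ℝ (Fin d)),
      ‖gradient f (k • x + w)‖ ≤ (1 + |k|) * C := by
    intro k w x
    have := hf.b1' (k • x + w)
    have := mul_nonneg (abs_nonneg k) hC
    linarith
  set h1 : EuclideanSpace ℝ (Fin d) × EuclideanSpace ℝ (Fin d) → ℝ := fun p =>
    f p.1 * (s * tr d (fderiv ℝ (gradient f) (c • p.1 + s • p.2))
      - ⟪p.2, gradient f (c • p.1 + s • p.2)⟫) with h1def
  set h3 : EuclideanSpace ℝ (Fin d) × EuclideanSpace ℝ (Fin d) → ℝ := fun p =>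
      ⟪gradient f p.1, gradient f (c • p.1 + s • p.2)⟫ with h3def
  set h2 : EuclideanSpace ℝ (Fin d) × EuclideanSpace ℝ (Fin d) → ℝ := fun p =>
    h3 p + f p.1 * (c * tr d (fderiv ℝ (gradient f) (c • p.1 + s • p.2))
      - ⟪p.1, gradient f (c • p.1 + s • p.2)⟫) with h2def
  have hin : ∀ (u v : EuclideanSpace ℝ (Fin d)), |⟪u, gradient f v⟫| ≤ ‖u‖ * C := fun u v =>
    (abs_real_inner_le_norm _ _).trans (by gcongr; exact hf.b1' v)
  have gen : ∀ (k : ℝ) (u x v : EuclideanSpace ℝ (Fin d)),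
      |f x * (k * tr d (fderiv ℝ (gradient f) v) - ⟪u, gradient f v⟫)|
        ≤ C * (|k| * (d * C) + ‖u‖ * C) := by
    intro k u x v
    rw [abs_mul]
    refine mul_le_mul (hf.b0 x) ((abs_sub _ _).trans ?_) (abs_nonneg _) hC
    rw [abs_mul]
    gcongr
    exacts [bl v, hin u v]
  have I3 : Integrable h3 ((stdGauss d).prod (stdGauss d)) := by
    refine integrable_lin2 d h3 (C * C) (by rw [h3def]; fun_prop) fun p => ?_
    have : |h3 p| ≤ C * C := (hin _ _).trans (by gcongr; exact hf.b1' _)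
    have := mul_nonneg (mul_nonneg hC hC) (norm_nonneg p.1)
    have := mul_nonneg (mul_nonneg hC hC) (norm_nonneg p.2)
    nlinarith
  have gen' : ∀ (k : ℝ) (q : EuclideanSpace ℝ (Fin d) × EuclideanSpace ℝ (Fin d) → EuclideanSpace ℝ (Fin d)),
      Continuous q → (∀ p, ‖q p‖ ≤ ‖p.1‖ + ‖p.2‖) →
      Integrable (fun p => f p.1 * (k * tr d (fderiv ℝ (gradient f) (c • p.1 + s • p.2))
        - ⟪q p, gradient f (c • p.1 + s • p.2)⟫)) ((stdGauss d).prod (stdGauss d)) := by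
    intro k q hq hqb
    refine integrable_lin2 d _ (C * (|k| * (d * C) + C)) ?_ fun p => ?_
    · have : Continuous fun p : EuclideanSpace ℝ (Fin d) × EuclideanSpace ℝ (Fin d) =>
        tr d (fderiv ℝ (gradient f) (c • p.1 + s • p.2)) := cl.comp (by fun_prop)
      fun_prop
    · refine (gen _ _ _ _).trans ?_
      rw [mul_assoc]
      refine mul_le_mul_of_nonneg_left ?_ hC
      have hk : 0 ≤ |k| * (d * C) := by positivity
      have h0 : 0 ≤ ‖p.1‖ + ‖p.2‖ := by positivity
      nlinarith [hqb p, mul_nonneg hk h0, mul_le_mul_of_nonneg_right (hqb p) hC]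
  have I1 : Integrable h1 ((stdGauss d).prod (stdGauss d)) :=
    gen' s (fun p => p.2) (by fun_prop) (fun p => by simp)
  have I2 : Integrable h2 ((stdGauss d).prod (stdGauss d)) :=
    I3.add (gen' c (fun p => p.1) (by fun_prop) (fun p => by simp))
  have Z1 : ∫ p, h1 p ∂((stdGauss d).prod (stdGauss d)) = 0 := by
    rw [integral_prod _ I1]
    refine integral_eq_zero_of_ae (Filter.Eventually.of_forall fun x => ?_)
    have := gauss_ibp d (fun y => gradient f (s • y + c • x)) ((1 + |s|) * C) (compC _ _)
      (compB0 _ _) (compB _ _)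
    simp only [h1def]
    rw [integral_const_mul]
    simp only [Pi.zero_apply]
    rw [mul_eq_zero]
    right
    rw [← this]
    congr 1
    ext y
    change _ = tr d _ - _
    rw [comp, tr_smul, add_comm]
  have Z2 : ∫ p, h2 p ∂((stdGauss d).prod (stdGauss d)) = 0 := by
    rw [integral_prod_symm _ I2]
    refine integral_eq_zero_of_ae (Filter.Eventually.of_forall fun y => ?_)
    have := gauss_ibp2 d (fun x => gradient f (c • x + s • y)) f ((1 + |c|) * C) C
      (hf.cd.of_le (by norm_num)) hf.b0 hf.b1 (compC _ _)
      (compB0 _ _) (compB _ _)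
    simp only [Pi.zero_apply]
    rw [← this]
    congr 1
    ext x
    simp only [h2def, h3def]
    rw [comp, tr_smul, fderiv_eq_inner, real_inner_comm]
  have key : ∀ p : EuclideanSpace ℝ (Fin d) × EuclideanSpace ℝ (Fin d),
      f p.1 * ⟪-s • p.1 + c • p.2, gradient f (c • p.1 + s • p.2)⟫
      = s * h2 p - c * h1 p - s * h3 p := by
    intro p
    simp only [h1def, h2def, inner_add_left, inner_smul_left]
    simp
    ring
  simp_rw [key]
  have J : Integrable (fun p => s * h2 p - c * h1 p) ((stdGauss d).prod (stdGauss d)) :=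
    (I2.const_mul s).sub (I1.const_mul c)
  rw [integral_sub J (I3.const_mul s),
    integral_sub (I2.const_mul s) (I1.const_mul c), integral_const_mul, integral_const_mul,
    integral_const_mul, Z1, Z2]
  ring

lemma rot_integral (d : ℕ) (c s : ℝ) (h : c ^ 2 + s ^ 2 = 1) (g : EuclideanSpace ℝ (Fin d) → ℝ)
    (hg : Continuous g) :
    ∫ p : EuclideanSpace ℝ (Fin d) × EuclideanSpace ℝ (Fin d), g (c • p.1 + s • p.2)
      ∂((stdGauss d).prod (stdGauss d)) = ∫ x, g x ∂(stdGauss d) := by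
  conv_rhs => rw [← stdGauss_rot_s9 d c s h]
  rw [integral_map (by fun_prop) hg.aestronglyMeasurable]

lemma poincare (d : ℕ) (f : EuclideanSpace ℝ (Fin d) → ℝ) (C : ℝ) (hf : Nice d f C) :
    ∫ x, f x ^ 2 ∂(stdGauss d) - (∫ x, f x ∂(stdGauss d)) ^ 2
      ≤ ∫ x, ‖gradient f x‖ ^ 2 ∂(stdGauss d) := by
  have hC : 0 ≤ C := (norm_nonneg _).trans (hf.b1 0)
  have cf : Continuous f := hf.cd.continuous
  have cg : Continuous (gradient f) := hf.g1.continuous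
  set D := ∫ x, ‖gradient f x‖ ^ 2 ∂(stdGauss d) with hD
  set φ : ℝ → ℝ := fun θ => ∫ p : EuclideanSpace ℝ (Fin d) × EuclideanSpace ℝ (Fin d),
    f p.1 * f (cos θ • p.1 + sin θ • p.2) ∂((stdGauss d).prod (stdGauss d)) with hφ
  have hder : ∀ θ, HasDerivAt φ (-sin θ * ∫ p : EuclideanSpace ℝ (Fin d) × EuclideanSpace ℝ (Fin d),
      ⟪gradient f p.1, gradient f (cos θ • p.1 + sin θ • p.2)⟫ ∂((stdGauss d).prod (stdGauss d))) θ := by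
    intro θ
    rw [← poincare_deriv d f C hf]
    refine (hasDerivAt_integral_of_dominated_loc_of_deriv_le (s := Set.univ)
      (bound := fun p => C * C * (1 + ‖p.1‖ + ‖p.2‖))
      (F' := fun θ (p : EuclideanSpace ℝ (Fin d) × EuclideanSpace ℝ (Fin d)) =>
        f p.1 * ⟪-sin θ • p.1 + cos θ • p.2, gradient f (cos θ • p.1 + sin θ • p.2)⟫)
      Filter.univ_mem ?_ ?_ ?_ ?_ ?_ ?_).2
    · refine Filter.Eventually.of_forall fun θ => ?_
      exact (by fun_prop : Continuous _).aestronglyMeasurable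
    · apply Integrable.of_bound (C := C * C)
      · exact (by fun_prop : Continuous _).aestronglyMeasurable
      · refine Filter.Eventually.of_forall fun p => ?_
        rw [norm_mul]
        exact mul_le_mul (hf.b0 _) (hf.b0 _) (norm_nonneg _) hC
    · exact (by fun_prop : Continuous _).aestronglyMeasurable
    · refine Filter.Eventually.of_forall fun p θ _ => ?_
      rw [norm_mul, mul_assoc]
      refine mul_le_mul (hf.b0 _) ?_ (norm_nonneg _) hC
      refine (norm_inner_le_norm _ _).trans ?_
      rw [mul_comm]
      refine mul_le_mul (hf.b1' _) ?_ (norm_nonneg _) hC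
      refine (norm_add_le _ _).trans ?_
      rw [norm_smul, norm_smul, norm_neg, Real.norm_eq_abs, Real.norm_eq_abs]
      have a1 := mul_le_mul_of_nonneg_right (abs_sin_le_one θ) (norm_nonneg p.1)
      have a2 := mul_le_mul_of_nonneg_right (abs_cos_le_one θ) (norm_nonneg p.2)
      linarith
    · exact (lin_integrable2 d).const_mul _
    · refine Filter.Eventually.of_forall fun p θ _ => ?_
      have h1 : HasDerivAt (fun θ => cos θ • p.1 + sin θ • p.2) (-sin θ • p.1 + cos θ • p.2) θ :=
        ((hasDerivAt_cos θ).smul_const p.1).add ((hasDerivAt_sin θ).smul_const p.2)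
      have h2 := (hf.cd.differentiable (by norm_num) (cos θ • p.1 + sin θ • p.2)).hasFDerivAt.comp_hasDerivAt θ h1
      rw [← fderiv_eq_inner]
      exact h2.const_mul (f p.1)
  have hbnd : ∀ θ, ∫ p : EuclideanSpace ℝ (Fin d) × EuclideanSpace ℝ (Fin d),
      ⟪gradient f p.1, gradient f (cos θ • p.1 + sin θ • p.2)⟫ ∂((stdGauss d).prod (stdGauss d)) ≤ D := by
    intro θ
    have bs : ∀ q : EuclideanSpace ℝ (Fin d) × EuclideanSpace ℝ (Fin d) → EuclideanSpace ℝ (Fin d),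
        Continuous q → Integrable (fun p => ‖gradient f (q p)‖ ^ 2) ((stdGauss d).prod (stdGauss d)) := by
      intro q hq
      refine Integrable.of_bound (Continuous.aestronglyMeasurable (by fun_prop)) (C ^ 2) ?_
      · refine Filter.Eventually.of_forall fun p => ?_
        rw [norm_pow, norm_norm]
        gcongr
        exact hf.b1' _
    have b1 := bs (fun p => p.1) (by fun_prop)
    have b2 := bs (fun p => cos θ • p.1 + sin θ • p.2) (by fun_prop)
    have e1 : ∫ p : EuclideanSpace ℝ (Fin d) × EuclideanSpace ℝ (Fin d), ‖gradient f p.1‖ ^ 2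
        ∂((stdGauss d).prod (stdGauss d)) = D := by
      simpa using rot_integral d 1 0 (by norm_num) (fun x => ‖gradient f x‖ ^ 2) (by fun_prop)
    have e2 : ∫ p : EuclideanSpace ℝ (Fin d) × EuclideanSpace ℝ (Fin d),
        ‖gradient f (cos θ • p.1 + sin θ • p.2)‖ ^ 2
        ∂((stdGauss d).prod (stdGauss d)) = D := by
      simpa using rot_integral d (cos θ) (sin θ) (by simp) (fun x => ‖gradient f x‖ ^ 2) (by fun_prop)
    calc _ ≤ ∫ p : EuclideanSpace ℝ (Fin d) × EuclideanSpace ℝ (Fin d),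
          (1/2 : ℝ) * (‖gradient f p.1‖ ^ 2 + ‖gradient f (cos θ • p.1 + sin θ • p.2)‖ ^ 2)
            ∂((stdGauss d).prod (stdGauss d)) := by
          refine integral_mono ?_ ((b1.add b2).const_mul _) fun p => ?_
          · apply Integrable.of_bound (C := C * C)
            · exact (by fun_prop : Continuous _).aestronglyMeasurable
            · refine Filter.Eventually.of_forall fun p => ?_
              refine (norm_inner_le_norm _ _).trans ?_
              exact mul_le_mul (hf.b1' _) (hf.b1' _) (norm_nonneg _) hC
          · have h1 := real_inner_le_norm (gradient f p.1) (gradient f (cos θ • p.1 + sin θ • p.2))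
            have h2 := sq_nonneg (‖gradient f p.1‖ - ‖gradient f (cos θ • p.1 + sin θ • p.2)‖)
            simp only
            nlinarith
      _ = D := by
          rw [integral_const_mul, integral_add b1 b2, e1, e2]; ring
  have hψ : ∀ θ, HasDerivAt (fun θ => φ θ - cos θ * D) _ θ := fun θ =>
    (hder θ).sub ((hasDerivAt_cos θ).mul_const D)
  have mono : MonotoneOn (fun θ => φ θ - cos θ * D) (Set.Icc 0 (π / 2)) := by
    refine monotoneOn_of_deriv_nonneg (convex_Icc _ _)
      (fun θ _ => (hψ θ).continuousAt.continuousWithinAt)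
      (fun θ _ => (hψ θ).differentiableAt.differentiableWithinAt) fun θ hθ => ?_
    rw [interior_Icc] at hθ
    rw [(hψ θ).deriv]
    have : 0 ≤ sin θ := sin_nonneg_of_nonneg_of_le_pi hθ.1.le (by linarith [hθ.2, pi_pos])
    nlinarith [mul_le_mul_of_nonneg_left (hbnd θ) this]
  have := mono (Set.left_mem_Icc.2 (by positivity)) (Set.right_mem_Icc.2 (by positivity)) (by positivity)
  have v0 : φ 0 = ∫ x, f x ^ 2 ∂(stdGauss d) := by
    have := rot_integral d 1 0 (by norm_num) (fun x => f x ^ 2) (by fun_prop)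
    rw [← this, hφ]
    simp [sq]
  have v1 : φ (π / 2) = (∫ x, f x ∂(stdGauss d)) ^ 2 := by
    rw [hφ]
    simp only [cos_pi_div_two, sin_pi_div_two, zero_smul, one_smul, zero_add]
    rw [integral_prod_mul f f, sq]
  simp only [v0, v1, cos_zero, cos_pi_div_two] at this
  linarith

/-- the generator -/
noncomputable def gen (d : ℕ) (α : ℝ)
    (b : EuclideanSpace ℝ (Fin d) → EuclideanSpace ℝ (Fin d))
    (f : EuclideanSpace ℝ (Fin d) → ℝ) (ξ : EuclideanSpace ℝ (Fin d)) : ℝ :=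
  ⟪b ξ, gradient f ξ⟫ + α * (lap d f ξ - ⟪ξ, gradient f ξ⟫)

lemma gen_cont (d : ℕ) (α : ℝ)
    (b : EuclideanSpace ℝ (Fin d) → EuclideanSpace ℝ (Fin d)) (hb : Continuous b)
    (f : EuclideanSpace ℝ (Fin d) → ℝ) (C : ℝ) (hf : Nice d f C) : Continuous (gen d α b f) := by
  have cg : Continuous (gradient f) := hf.g1.continuous
  have cl : Continuous (lap d f) :=
    (tr_cont d).comp (hf.g1.continuous_fderiv (by norm_num))
  unfold gen
  fun_prop

lemma gen_bound (d : ℕ) (α : ℝ) (hα : 0 ≤ α)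
    (b : EuclideanSpace ℝ (Fin d) → EuclideanSpace ℝ (Fin d)) (B : ℝ) (hb : ∀ x, ‖b x‖ ≤ B)
    (f : EuclideanSpace ℝ (Fin d) → ℝ) (C : ℝ) (hf : Nice d f C) (x : EuclideanSpace ℝ (Fin d)) :
    |gen d α b f x| ≤ (B * C + α * (d * C) + α * C) * (1 + ‖x‖) := by
  have hC : 0 ≤ C := (norm_nonneg _).trans (hf.b1 0)
  have hB : 0 ≤ B := (norm_nonneg _).trans (hb 0)
  have a1 : |⟪b x, gradient f x⟫| ≤ B * C :=
    (abs_real_inner_le_norm _ _).trans (mul_le_mul (hb x) (hf.b1' x) (norm_nonneg _) hB)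
  have a2 : |⟪x, gradient f x⟫| ≤ ‖x‖ * C :=
    (abs_real_inner_le_norm _ _).trans (by gcongr; exact hf.b1' x)
  have a3 : |lap d f x| ≤ d * C := (tr_bound d _).trans (by gcongr; exact hf.b2 x)
  have a4 : |α * (lap d f x - ⟪x, gradient f x⟫)| ≤ α * (d * C + ‖x‖ * C) := by
    rw [abs_mul, abs_of_nonneg hα]
    gcongr
    exact (abs_sub _ _).trans (add_le_add a3 a2)
  have a5 := (abs_add_le (⟪b x, gradient f x⟫) (α * (lap d f x - ⟪x, gradient f x⟫)))
  have n1 : 0 ≤ B * C * ‖x‖ := by positivity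
  have n2 : 0 ≤ α * (d * C) * ‖x‖ := by positivity
  have n3 : 0 ≤ α * C := by positivity
  unfold gen
  nlinarith

/-- invariance and dissipation -/
lemma gen_integrals (d : ℕ) (α : ℝ)
    (b : EuclideanSpace ℝ (Fin d) → EuclideanSpace ℝ (Fin d)) (B : ℝ) (hb : ∀ x, ‖b x‖ ≤ B)
    (hb' : ∀ x, ‖fderiv ℝ b x‖ ≤ B) (hbc : ContDiff ℝ 1 b)
    (hdiv : ∀ ξ, tr d (fderiv ℝ b ξ) = 0) (horth : ∀ ξ, ⟪b ξ, ξ⟫ = 0)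
    (f : EuclideanSpace ℝ (Fin d) → ℝ) (C : ℝ) (hf : Nice d f C) :
    ∫ x, gen d α b f x ∂(stdGauss d) = 0 ∧
    ∫ x, f x * gen d α b f x ∂(stdGauss d) = - α * ∫ x, ‖gradient f x‖ ^ 2 ∂(stdGauss d) := by
  have hC : 0 ≤ C := (norm_nonneg _).trans (hf.b1 0)
  have hB : 0 ≤ B := (norm_nonneg _).trans (hb 0)
  have cf : Continuous f := hf.cd.continuous
  have cg : Continuous (gradient f) := hf.g1.continuous
  have cb : Continuous b := hbc.continuous
  have cl : Continuous (lap d f) :=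
    (tr_cont d).comp (hf.g1.continuous_fderiv (by norm_num))
  have hf1 : ContDiff ℝ 1 f := hf.cd.of_le (by norm_num)
  have o : ∀ x, ⟪x, b x⟫ = 0 := fun x => by rw [real_inner_comm]; exact horth x
  have a1 : ∀ x, |⟪b x, gradient f x⟫| ≤ B * C := fun x =>
    (abs_real_inner_le_norm _ _).trans (mul_le_mul (hb x) (hf.b1' x) (norm_nonneg _) hB)
  have a4 : ∀ x, |lap d f x - ⟪x, gradient f x⟫| ≤ (d * C + C) * (1 + ‖x‖) := by
    intro x
    have a2 : |⟪x, gradient f x⟫| ≤ ‖x‖ * C :=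
      (abs_real_inner_le_norm _ _).trans (by gcongr; exact hf.b1' x)
    have a3 : |lap d f x| ≤ d * C := (tr_bound d _).trans (by gcongr; exact hf.b2 x)
    have := (abs_sub (lap d f x) (⟪x, gradient f x⟫))
    have n2 : 0 ≤ (d * C) * ‖x‖ := by positivity
    nlinarith
  have I1 : Integrable (fun x => ⟪b x, gradient f x⟫) (stdGauss d) :=
    Integrable.of_bound (Continuous.aestronglyMeasurable (by fun_prop)) (B * C)
      (Filter.Eventually.of_forall a1)
  have I1f : Integrable (fun x => f x * ⟪b x, gradient f x⟫) (stdGauss d) :=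
    Integrable.of_bound (Continuous.aestronglyMeasurable (by fun_prop)) (C * (B * C))
      (Filter.Eventually.of_forall fun x => by
        rw [norm_mul]
        exact mul_le_mul (hf.b0 x) (a1 x) (norm_nonneg _) hC)
  have I2 : Integrable (fun x => lap d f x - ⟪x, gradient f x⟫) (stdGauss d) :=
    integrable_lin d _ _ (by fun_prop) a4
  have I2f : Integrable (fun x => f x * (lap d f x - ⟪x, gradient f x⟫)) (stdGauss d) :=
    integrable_lin d _ (C * (d * C + C)) (by fun_prop) fun x => by
      rw [abs_mul, mul_assoc]
      exact mul_le_mul (hf.b0 x) (a4 x) (abs_nonneg _) hC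
  have I3 : Integrable (fun x => ‖gradient f x‖ ^ 2) (stdGauss d) :=
    Integrable.of_bound (Continuous.aestronglyMeasurable (by fun_prop)) (C ^ 2)
      (Filter.Eventually.of_forall fun x => by
        rw [norm_pow, norm_norm]
        gcongr
        exact hf.b1' _)
  have Z1 : ∫ x, ⟪b x, gradient f x⟫ ∂(stdGauss d) = 0 := by
    have := gauss_ibp2 d b f B C hf1 hf.b0 hf.b1 hbc hb hb'
    simpa only [hdiv, o, fderiv_eq_inner, sub_zero, mul_zero, add_zero] using this
  have Z1f : ∫ x, f x * ⟪b x, gradient f x⟫ ∂(stdGauss d) = 0 := by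
    have hfd : ∀ x, fderiv ℝ (fun x => f x ^ 2) x = (2 * f x) • fderiv ℝ f x := by
      intro x
      have := ((hf1.differentiable (by norm_num) x).hasFDerivAt.pow 2).fderiv
      simpa using this
    have := gauss_ibp2 d b (fun x => f x ^ 2) B (2 * C * C) (hf1.pow 2) ?_ ?_ hbc hb hb'
    · simp only [hfd, hdiv, o, sub_zero, mul_zero, add_zero, _root_.smul_apply, smul_eq_mul,
        fderiv_eq_inner, mul_assoc] at this
      rw [integral_const_mul] at this
      linarith
    · intro x
      rw [abs_pow]
      nlinarith [hf.b0 x, abs_nonneg (f x)]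
    · intro x
      rw [hfd, norm_smul, norm_mul]
      refine mul_le_mul ?_ (hf.b1 x) (norm_nonneg _) (by positivity)
      simpa using hf.b0 x
  have Z2 : ∫ x, (lap d f x - ⟪x, gradient f x⟫) ∂(stdGauss d) = 0 :=
    gauss_ibp d (gradient f) C hf.g1 hf.b1' hf.b2
  have Z2f : ∫ x, f x * (lap d f x - ⟪x, gradient f x⟫) ∂(stdGauss d)
      = - ∫ x, ‖gradient f x‖ ^ 2 ∂(stdGauss d) := by
    have := gauss_ibp2 d (gradient f) f C C hf1 hf.b0 hf.b1 hf.g1 hf.b1' hf.b2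
    simp only [fderiv_eq_inner, real_inner_self_eq_norm_sq, ← lap_eq] at this
    rw [integral_add I3 I2f] at this
    linarith
  constructor
  · simp only [gen]
    rw [integral_add I1 (I2.const_mul α), integral_const_mul, Z1, Z2]
    simp
  · have e : ∀ x, f x * gen d α b f x
      = f x * ⟪b x, gradient f x⟫ + α * (f x * (lap d f x - ⟪x, gradient f x⟫)) := by
      intro x; simp only [gen]; ring
    simp_rw [e]
    rw [integral_add I1f (I2f.const_mul α), integral_const_mul, Z1f, Z2f]
    ring

end helpers

theorem stmt9 (d : ℕ) (α : ℝ) (hα : 0 ≤ α)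
    (b : EuclideanSpace ℝ (Fin d) → EuclideanSpace ℝ (Fin d))
    (hbsmooth : ContDiff ℝ (⊤ : ℕ∞) b) (hbsupp : HasCompactSupport b)
    (hdiv : ∀ ξ, LinearMap.trace ℝ (EuclideanSpace ℝ (Fin d))
      (fderiv ℝ b ξ : EuclideanSpace ℝ (Fin d) →ₗ[ℝ] EuclideanSpace ℝ (Fin d)) = 0)
    (horth : ∀ ξ, ⟪b ξ, ξ⟫ = 0)
    (ρ : ℝ → EuclideanSpace ℝ (Fin d) → ℝ)
    (hbd : ∃ C, ∀ t ≥ (0 : ℝ), ∀ ξ, |ρ t ξ| ≤ C)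
    (htreg : ∀ ξ, ContDiffOn ℝ 1 (fun t => ρ t ξ) (Set.Ici 0))
    (hxreg : ∀ t ≥ (0 : ℝ), ContDiff ℝ 2 (ρ t))
    (hxbd : ∃ C, ∀ t ≥ (0 : ℝ), ∀ ξ, ‖iteratedFDeriv ℝ 1 (ρ t) ξ‖ ≤ C ∧
      ‖iteratedFDeriv ℝ 2 (ρ t) ξ‖ ≤ C)
    (hinf : ∀ T > (0 : ℝ), ∃ ε > (0 : ℝ), ∀ t ∈ Set.Icc (0 : ℝ) T, ∀ ξ, ε ≤ ρ t ξ)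
    (hpde : ∀ t > (0 : ℝ), ∀ ξ, HasDerivAt (fun s => ρ s ξ)
      (⟪b ξ, gradient (ρ t) ξ⟫ + α * (lap d (ρ t) ξ - ⟪ξ, gradient (ρ t) ξ⟫)) t) :
    ∀ t ≥ (0 : ℝ),
      ∫ ξ, (ρ t ξ - ∫ η, ρ 0 η ∂(stdGauss d)) ^ 2 ∂(stdGauss d) ≤
        Real.exp (-2 * α * t) * ∫ ξ, (ρ 0 ξ - ∫ η, ρ 0 η ∂(stdGauss d)) ^ 2 ∂(stdGauss d) := by
  obtain ⟨C₀, hC₀⟩ := hbd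
  obtain ⟨C₁, hC₁⟩ := hxbd
  set C := max C₀ C₁
  have nice : ∀ t ≥ (0 : ℝ), Nice d (ρ t) C := fun t ht =>
    nice_mk d (ρ t) C₀ C₁ (hxreg t ht) (hC₀ t ht) (hC₁ t ht)
  have hC : 0 ≤ C := (norm_nonneg _).trans ((nice 0 le_rfl).b1 0)
  have hb1 : ContDiff ℝ 1 b := hbsmooth.of_le (by exact_mod_cast le_top)
  obtain ⟨B₀, hB₀⟩ := hbsupp.exists_bound_of_continuous hb1.continuous
  obtain ⟨B₁, hB₁⟩ := (hbsupp.fderiv (𝕜 := ℝ)).exists_bound_of_continuous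
    (hb1.continuous_fderiv (by norm_num))
  set B := max B₀ B₁
  have hB : ∀ x, ‖b x‖ ≤ B := fun x => (hB₀ x).trans (le_max_left _ _)
  have hB' : ∀ x, ‖fderiv ℝ b x‖ ≤ B := fun x => (hB₁ x).trans (le_max_right _ _)
  set A := B * C + α * (d * C) + α * C
  have hints := fun t (ht : t ≥ (0 : ℝ)) =>
    gen_integrals d α b B hB hB' hb1 hdiv horth (ρ t) C (nice t ht)
  have hlin : ∀ K : ℝ, Integrable (fun x : EuclideanSpace ℝ (Fin d) => K * (1 + ‖x‖)) (stdGauss d) :=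
    fun K => ((integrable_const 1).add (stdGauss_norm_integrable d)).const_mul K
  have i1 : ∀ t ≥ (0 : ℝ), Integrable (ρ t) (stdGauss d) := fun t ht =>
    Integrable.of_bound (hxreg t ht).continuous.aestronglyMeasurable C
      (Filter.Eventually.of_forall (nice t ht).b0)
  have b2 : ∀ t ≥ (0 : ℝ), ∀ x, ‖ρ t x ^ 2‖ ≤ C ^ 2 := fun t ht x => by
    rw [norm_pow]
    gcongr
    exact (nice t ht).b0 x
  have i2 : ∀ t ≥ (0 : ℝ), Integrable (fun x => ρ t x ^ 2) (stdGauss d) := fun t ht =>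
    Integrable.of_bound ((hxreg t ht).continuous.pow 2).aestronglyMeasurable (C ^ 2)
      (Filter.Eventually.of_forall (b2 t ht))
  set M : ℝ → ℝ := fun t => ∫ x, ρ t x ∂(stdGauss d) with hM
  set Q : ℝ → ℝ := fun t => ∫ x, ρ t x ^ 2 ∂(stdGauss d) with hQ
  have cM : ContinuousOn M (Set.Ici 0) := by
    refine continuousOn_of_dominated (bound := fun _ => C)
      (fun t ht => (i1 t ht).aestronglyMeasurable)
      (fun t ht => Filter.Eventually.of_forall (nice t ht).b0) (integrable_const _)
      (Filter.Eventually.of_forall fun x => (htreg x).continuousOn)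
  have cQ : ContinuousOn Q (Set.Ici 0) := by
    refine continuousOn_of_dominated (bound := fun _ => C ^ 2)
      (fun t ht => (i2 t ht).aestronglyMeasurable)
      (fun t ht => Filter.Eventually.of_forall (b2 t ht)) (integrable_const _)
      (Filter.Eventually.of_forall fun x => (htreg x).continuousOn.pow 2)
  have dM : ∀ t > (0 : ℝ), HasDerivAt M 0 t := by
    intro t ht
    rw [← (hints t ht.le).1]
    refine (hasDerivAt_integral_of_dominated_loc_of_deriv_le (s := Set.Ioi 0)
      (bound := fun x => A * (1 + ‖x‖)) (F' := fun t x => gen d α b (ρ t) x)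
      (Ioi_mem_nhds ht) ?_ (i1 t ht.le) ?_ ?_ (hlin A) ?_).2
    · filter_upwards [Ioi_mem_nhds ht] with s hs using (i1 s (le_of_lt hs)).aestronglyMeasurable
    · exact (gen_cont d α b hb1.continuous (ρ t) C (nice t ht.le)).aestronglyMeasurable
    · exact Filter.Eventually.of_forall fun x s hs =>
        gen_bound d α hα b B hB (ρ s) C (nice s (le_of_lt hs)) x
    · exact Filter.Eventually.of_forall fun x s hs => hpde s hs x
  have dQ : ∀ t > (0 : ℝ), HasDerivAt Q (-2 * α * ∫ x, ‖gradient (ρ t) x‖ ^ 2 ∂(stdGauss d)) t := by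
    intro t ht
    have e : -2 * α * ∫ x, ‖gradient (ρ t) x‖ ^ 2 ∂(stdGauss d)
        = ∫ x, 2 * (ρ t x * gen d α b (ρ t) x) ∂(stdGauss d) := by
      rw [integral_const_mul, (hints t ht.le).2]; ring
    rw [e]
    refine (hasDerivAt_integral_of_dominated_loc_of_deriv_le (s := Set.Ioi 0)
      (bound := fun x => (2 * C * A) * (1 + ‖x‖))
      (F' := fun t x => 2 * (ρ t x * gen d α b (ρ t) x))
      (Ioi_mem_nhds ht) ?_ (i2 t ht.le) ?_ ?_ (hlin _) ?_).2
    · filter_upwards [Ioi_mem_nhds ht] with s hs using (i2 s (le_of_lt hs)).aestronglyMeasurable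
    · exact (continuous_const.mul ((hxreg t ht.le).continuous.mul
        (gen_cont d α b hb1.continuous (ρ t) C (nice t ht.le)))).aestronglyMeasurable
    · refine Filter.Eventually.of_forall fun x s hs => ?_
      have h1 := gen_bound d α hα b B hB (ρ s) C (nice s (le_of_lt hs)) x
      have h2 := mul_le_mul ((nice s (le_of_lt hs)).b0 x) h1 (abs_nonneg _) hC
      rw [norm_mul, norm_mul, Real.norm_eq_abs, Real.norm_eq_abs, Real.norm_eq_abs, abs_two]
      calc _ ≤ 2 * (C * (A * (1 + ‖x‖))) := by gcongr
        _ = _ := by ring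
    · refine Filter.Eventually.of_forall fun x s hs => ?_
      have := (hpde s hs x).pow 2
      convert! this using 1
      simp [gen]
      ring
  have Mc : ∀ t ≥ (0 : ℝ), M t = M 0 := by
    intro t ht
    have h0 : ∀ s ∈ interior (Set.Ici (0 : ℝ)), deriv M s = 0 := by
      rw [interior_Ici]
      exact fun s hs => (dM s hs).deriv
    have hd : DifferentiableOn ℝ M (interior (Set.Ici (0 : ℝ))) := by
      rw [interior_Ici]
      exact fun s hs => (dM s hs).differentiableAt.differentiableWithinAt
    have m1 := antitoneOn_of_deriv_nonpos (convex_Ici 0) cM hd (fun s hs => (h0 s hs).le)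
      (Set.mem_Ici.2 le_rfl) (Set.mem_Ici.2 ht) ht
    have m2 := monotoneOn_of_deriv_nonneg (convex_Ici 0) cM hd (fun s hs => (h0 s hs).ge)
      (Set.mem_Ici.2 le_rfl) (Set.mem_Ici.2 ht) ht
    exact le_antisymm m1 m2
  have anti : AntitoneOn (fun t => Real.exp (2 * α * t) * (Q t - M 0 ^ 2)) (Set.Ici 0) := by
    have hder : ∀ t > (0 : ℝ), HasDerivAt (fun t => Real.exp (2 * α * t) * (Q t - M 0 ^ 2))
        (Real.exp (2 * α * t) * (2 * α) * (Q t - M 0 ^ 2) + Real.exp (2 * α * t) *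
          (-2 * α * ∫ x, ‖gradient (ρ t) x‖ ^ 2 ∂(stdGauss d))) t := by
      intro t ht
      have h1 : HasDerivAt (fun t : ℝ => Real.exp (2 * α * t)) (Real.exp (2 * α * t) * (2 * α)) t := by
        simpa using ((hasDerivAt_id t).const_mul (2 * α)).exp
      exact h1.mul ((dQ t ht).sub_const _)
    refine antitoneOn_of_deriv_nonpos (convex_Ici 0) ?_ ?_ ?_
    · exact (Continuous.continuousOn (by fun_prop)).mul (cQ.sub continuousOn_const)
    · rw [interior_Ici]
      exact fun t ht => (hder t ht).differentiableAt.differentiableWithinAt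
    · rw [interior_Ici]
      intro t ht
      have ht' : (0 : ℝ) < t := ht
      rw [(hder t ht).deriv]
      have hp := poincare d (ρ t) C (nice t ht'.le)
      have hm : ∫ x, ρ t x ∂(stdGauss d) = M 0 := Mc t ht'.le
      rw [hm] at hp
      have : 0 ≤ Real.exp (2 * α * t) * (2 * α) := by positivity
      have hp' : Q t - M 0 ^ 2 - ∫ x, ‖gradient (ρ t) x‖ ^ 2 ∂(stdGauss d) ≤ 0 := by
        linarith
      nlinarith [mul_nonpos_of_nonneg_of_nonpos this hp']
  have var : ∀ t ≥ (0 : ℝ), ∫ ξ, (ρ t ξ - M 0) ^ 2 ∂(stdGauss d) = Q t - M 0 ^ 2 := by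
    intro t ht
    have e : ∀ x, (ρ t x - M 0) ^ 2 = ρ t x ^ 2 - 2 * M 0 * ρ t x + M 0 ^ 2 := fun x => by ring
    simp_rw [e]
    have j : Integrable (fun x => ρ t x ^ 2 - 2 * M 0 * ρ t x) (stdGauss d) :=
      (i2 t ht).sub ((i1 t ht).const_mul _)
    have hm : ∫ x, ρ t x ∂(stdGauss d) = M 0 := Mc t ht
    rw [integral_add j (integrable_const _), integral_sub (i2 t ht) ((i1 t ht).const_mul _),
      integral_const_mul, hm]
    simp [hQ]
    ring
  intro t ht
  change ∫ ξ, (ρ t ξ - M 0) ^ 2 ∂(stdGauss d) ≤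
    Real.exp (-2 * α * t) * ∫ ξ, (ρ 0 ξ - M 0) ^ 2 ∂(stdGauss d)
  rw [var t ht, var 0 le_rfl]
  have := anti (Set.mem_Ici.2 le_rfl) (Set.mem_Ici.2 ht) ht
  simp only [mul_zero, Real.exp_zero, one_mul] at this
  have h2 : Real.exp (-2 * α * t) * Real.exp (2 * α * t) = 1 := by
    rw [← Real.exp_add]; simp
  calc Q t - M 0 ^ 2 = Real.exp (-2 * α * t) * (Real.exp (2 * α * t) * (Q t - M 0 ^ 2)) := by
        rw [← mul_assoc, h2, one_mul]
    _ ≤ _ := by gcongr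
end
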